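/- arXiv:dg-ga/9410005 — 5 statements merged into one kernel-verified Lean document; each statement's English description precedes it below -/
import Mathlib

section
/- (Closure of harmonic holomorphic maps under holomorphic postcomposition.) Let U ⊆ ℝ^{2m} ≅ ℂ^m be open, let M : U → so(m,ℂ) be a map into the skew-symmetric complex m×m matrices, and let φ : U → ℂ^p be a smooth M-holomorphic map each of whose components is harmonic (Δφ^l = 0). Let V ⊆ ℂ^p be open with φ(U) ⊆ V and let f : V → ℂ^q be holomorphic. Then the composition f∘φ : U → ℂ^q is M-holomorphic and each of its components is harmonic. -/
open Complex BigOperators Matrix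

/-- Partial derivative in the direction of the real coordinate `x^{2j-1}`,
identifying `ℝ^{2m} ≅ ℂ^m` via `q^j = x^{2j-1} + i x^{2j}`. -/
noncomputable def pdRe {m : ℕ} (f : (Fin m → ℂ) → ℂ) (j : Fin m) (x : Fin m → ℂ) : ℂ :=
  fderiv ℝ f x (Pi.single j 1)

/-- Partial derivative in the direction of the real coordinate `x^{2j}`. -/
noncomputable def pdIm {m : ℕ} (f : (Fin m → ℂ) → ℂ) (j : Fin m) (x : Fin m → ℂ) : ℂ :=
  fderiv ℝ f x (Pi.single j Complex.I)

/-- Wirtinger derivative `∂f/∂q^j = ½(∂f/∂x^{2j-1} − i ∂f/∂x^{2j})`. -/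
noncomputable def wdq {m : ℕ} (f : (Fin m → ℂ) → ℂ) (j : Fin m) (x : Fin m → ℂ) : ℂ :=
  (pdRe f j x - Complex.I * pdIm f j x) / 2

/-- Wirtinger derivative `∂f/∂q̄^j = ½(∂f/∂x^{2j-1} + i ∂f/∂x^{2j})`. -/
noncomputable def wdqbar {m : ℕ} (f : (Fin m → ℂ) → ℂ) (j : Fin m) (x : Fin m → ℂ) : ℂ :=
  (pdRe f j x + Complex.I * pdIm f j x) / 2

/-- Laplacian `Δf = Σ_{i=1}^{2m} ∂²f/(∂x^i)²`. -/
noncomputable def lap {m : ℕ} (f : (Fin m → ℂ) → ℂ) (x : Fin m → ℂ) : ℂ :=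
  ∑ j, (pdRe (fun y => pdRe f j y) j x + pdIm (fun y => pdIm f j y) j x)

/-- The horizontal weak conformality quantity `Σ_{i=1}^{2m} (∂f/∂x^i)²`. -/
noncomputable def hwc {m : ℕ} (f : (Fin m → ℂ) → ℂ) (x : Fin m → ℂ) : ℂ :=
  ∑ j, ((pdRe f j x) ^ 2 + (pdIm f j x) ^ 2)


open Metric MeasureTheory in
lemma aux_bound {E : Type*} [NormedAddCommGroup E] [NormedSpace ℂ E] (V : Set E) (hV : IsOpen V)
    (g : E → ℂ) (hg : DifferentiableOn ℂ g V) (z₀ : E) (hz₀ : z₀ ∈ V) :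
    ∃ R > 0, ball z₀ (2 * R) ⊆ V ∧ ∀ z ∈ ball z₀ (2 * R), ‖fderiv ℂ g z‖ ≤ 2 / R := by
  have hc : ContinuousAt g z₀ := (hg.differentiableAt (hV.mem_nhds hz₀)).continuousAt
  obtain ⟨ε, hε, h1⟩ := Metric.mem_nhds_iff.1
    (Filter.inter_mem (hV.mem_nhds hz₀) (hc (ball_mem_nhds (g z₀) one_pos)))
  refine ⟨ε / 3, by positivity, fun z hz => (h1 (ball_subset_ball (by linarith) hz)).1, ?_⟩
  intro z hz
  have hsub : ball z (ε / 3) ⊆ ball z₀ ε := by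
    apply ball_subset_ball'
    have := mem_ball.1 hz
    linarith
  refine Complex.norm_fderiv_le_div_of_mapsTo_ball (R₁ := ε / 3) (R₂ := 2)
    (hg.mono (fun w hw => (h1 (hsub hw)).1)) ?_ (by positivity)
  intro w hw
  have a1 : dist (g w) (g z₀) < 1 := (h1 (hsub hw)).2
  have a2 : dist (g z) (g z₀) < 1 := (h1 (hsub (mem_ball_self (by positivity)))).2
  have := dist_triangle_right (g w) (g z) (g z₀)
  apply mem_closedBall.2
  linarith

open Metric MeasureTheory in
lemma aux_diff {p : ℕ} (V : Set (Fin p → ℂ)) (hV : IsOpen V)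
    (g : (Fin p → ℂ) → ℂ) (hg : DifferentiableOn ℂ g V) (z₀ : Fin p → ℂ) (hz₀ : z₀ ∈ V)
    (v : Fin p → ℂ) :
    DifferentiableAt ℂ (fun z => fderiv ℂ g z v) z₀ := by
  obtain ⟨R, hR, hRV, hb⟩ := aux_bound V hV g hg z₀ hz₀
  obtain ⟨r, hr, hrv⟩ : ∃ r > 0, r * ‖v‖ < R := by
    refine ⟨R / (‖v‖ + 1), by positivity, ?_⟩
    rw [div_mul_eq_mul_div, div_lt_iff₀ (by positivity)]
    nlinarith [norm_nonneg v]
  have hmem : ∀ z ∈ ball z₀ R, ∀ w : ℂ, ‖w‖ ≤ r → z + w • v ∈ ball z₀ (2 * R) := by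
    intro z hz w hw
    rw [mem_ball, dist_eq_norm] at hz ⊢
    have e : z + w • v - z₀ = (z - z₀) + w • v := by abel
    have : ‖w • v‖ ≤ r * ‖v‖ := by rw [norm_smul]; gcongr
    rw [e]
    have := norm_add_le (z - z₀) (w • v)
    linarith
  have hgd : ∀ z ∈ ball z₀ (2 * R), DifferentiableAt ℂ g z := fun z hz =>
    hg.differentiableAt (hV.mem_nhds (hRV hz))
  have hcau : ∀ z ∈ ball z₀ R, fderiv ℂ g z v =
      (2 * Real.pi * Complex.I : ℂ)⁻¹ * ∫ θ in Set.Ioc 0 (2 * Real.pi),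
        (deriv (circleMap 0 r) θ * ((circleMap 0 r θ) ^ 2)⁻¹) * g (z + circleMap 0 r θ • v) := by
    intro z hz
    have hline : ∀ w : ℂ, HasDerivAt (fun w : ℂ => z + w • v) v w := fun w => by
      simpa using ((hasDerivAt_id w).smul_const v).const_add z
    have hopen : IsOpen (Set.preimage (fun w : ℂ => z + w • v) (ball z₀ (2 * R))) :=
      isOpen_ball.preimage (by fun_prop)
    have h := Complex.cderiv_eq_deriv (r := r) (z := 0) (f := fun w : ℂ => g (z + w • v)) hopen
      (fun w hw => (DifferentiableAt.comp (g := g) w (hgd _ hw)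
        (hline w).differentiableAt).differentiableWithinAt) hr
      (fun w hw => hmem z hz w (by simpa using hw))
    have hz2 : z ∈ ball z₀ (2 * R) := ball_subset_ball (by linarith) hz
    have h2 : deriv (fun w : ℂ => g (z + w • v)) 0 = fderiv ℂ g z v := by
      have : HasFDerivAt g (fderiv ℂ g z) (z + (0 : ℂ) • v) := by
        simpa using (hgd z hz2).hasFDerivAt
      exact (this.comp_hasDerivAt (0 : ℂ) (hline 0)).deriv
    rw [← h2, ← h, Complex.cderiv, circleIntegral,
      intervalIntegral.integral_of_le Real.two_pi_pos.le]
    simp [mul_assoc]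
  have hev : (fun z => fderiv ℂ g z v) =ᶠ[nhds z₀] fun z =>
      (2 * Real.pi * Complex.I : ℂ)⁻¹ * ∫ θ in Set.Ioc 0 (2 * Real.pi),
        (deriv (circleMap 0 r) θ * ((circleMap 0 r θ) ^ 2)⁻¹) * g (z + circleMap 0 r θ • v) :=
    Filter.eventuallyEq_of_mem (ball_mem_nhds z₀ hR) hcau
  refine DifferentiableAt.congr_of_eventuallyEq ?_ hev
  refine DifferentiableAt.const_mul ?_ _
  have hcm : ∀ θ, ‖circleMap 0 r θ‖ ≤ r := fun θ => by simp [abs_of_pos hr]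
  have hc0 : ∀ θ, circleMap 0 r θ ≠ 0 := fun θ => circleMap_ne_center hr.ne'
  have hcc : Continuous fun θ => deriv (circleMap 0 r) θ * ((circleMap 0 r θ) ^ 2)⁻¹ := by
    simp only [deriv_circleMap]
    exact ((continuous_circleMap 0 r).mul continuous_const).mul
      (((continuous_circleMap 0 r).pow 2).inv₀ (fun θ => pow_ne_zero _ (hc0 θ)))
  have hFc : ∀ z ∈ ball z₀ R, Continuous fun θ =>
      (deriv (circleMap 0 r) θ * ((circleMap 0 r θ) ^ 2)⁻¹) * g (z + circleMap 0 r θ • v) := by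
    intro z hz
    refine hcc.mul (continuous_iff_continuousAt.2 fun θ => ?_)
    refine ContinuousAt.comp (g := g) (f := fun θ => z + circleMap 0 r θ • v)
      (hgd _ (hmem z hz _ (hcm θ))).continuousAt ?_
    exact (continuous_const.add ((continuous_circleMap 0 r).smul continuous_const)).continuousAt
  have hcn : ∀ θ, ‖deriv (circleMap 0 r) θ * ((circleMap 0 r θ) ^ 2)⁻¹‖ = r⁻¹ := by
    intro θ
    simp [deriv_circleMap, abs_of_pos hr]
    field_simp
  refine (hasFDerivAt_integral_of_dominated_of_fderiv_le (𝕜 := ℂ)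
    (F := fun z θ => (deriv (circleMap 0 r) θ * ((circleMap 0 r θ) ^ 2)⁻¹) *
      g (z + circleMap 0 r θ • v))
    (F' := fun z θ => (deriv (circleMap 0 r) θ * ((circleMap 0 r θ) ^ 2)⁻¹) •
      fderiv ℂ g (z + circleMap 0 r θ • v))
    (bound := fun _ => r⁻¹ * (2 / R))
    (ball_mem_nhds z₀ hR) ?_ ?_ ?_ ?_ ?_ ?_).differentiableAt
  · filter_upwards [ball_mem_nhds z₀ hR] with z hz
    exact (hFc z hz).aestronglyMeasurable
  · exact (hFc z₀ (mem_ball_self hR)).integrableOn_Ioc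
  · refine hcc.aestronglyMeasurable.smul (Measurable.aestronglyMeasurable ?_)
    exact (measurable_fderiv ℂ g).comp
      (continuous_const.add ((continuous_circleMap 0 r).smul continuous_const)).measurable
  · refine Filter.Eventually.of_forall fun θ z hz => ?_
    rw [norm_smul, hcn]
    gcongr
    exact hb _ (hmem z hz _ (hcm θ))
  · exact integrable_const _
  · refine Filter.Eventually.of_forall fun θ z hz => ?_
    have h1 : HasFDerivAt g (fderiv ℂ g (z + circleMap 0 r θ • v)) (z + circleMap 0 r θ • v) :=
      (hgd _ (hmem z hz _ (hcm θ))).hasFDerivAt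
    have h2 := h1.comp z ((hasFDerivAt_id (𝕜 := ℂ) z).add_const (circleMap 0 r θ • v))
    simpa using h2.const_mul (deriv (circleMap 0 r) θ * ((circleMap 0 r θ) ^ 2)⁻¹)

lemma aux_chain {m p : ℕ} (g : (Fin p → ℂ) → ℂ) (φ : (Fin m → ℂ) → Fin p → ℂ) (y : Fin m → ℂ)
    (hg : DifferentiableAt ℂ g (φ y)) (hφ : DifferentiableAt ℝ φ y) (e : Fin m → ℂ) :
    fderiv ℝ (fun y => g (φ y)) y e =
      ∑ a, fderiv ℂ g (φ y) (Pi.single a 1) * fderiv ℝ (fun y => φ y a) y e := by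
  have h1 : HasFDerivAt g ((fderiv ℂ g (φ y)).restrictScalars ℝ) (φ y) :=
    hg.hasFDerivAt.restrictScalars ℝ
  have h2 : fderiv ℝ (fun y => g (φ y)) y e = fderiv ℂ g (φ y) (fderiv ℝ φ y e) := by
    have h := (h1.comp y hφ.hasFDerivAt).fderiv
    change fderiv ℝ (g ∘ φ) y e = _
    rw [h]
    rfl
  have h3 : ∀ a, fderiv ℝ (fun y => φ y a) y e = fderiv ℝ φ y e a := fun a => by
    rw [((hasFDerivAt_pi'.1 hφ.hasFDerivAt) a).fderiv]
    rfl
  rw [h2]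
  conv_lhs => rw [pi_eq_sum_univ' (fderiv ℝ φ y e)]
  simp only [map_sum, map_smul, smul_eq_mul, h3]
  refine Finset.sum_congr rfl fun a _ => ?_
  rw [mul_comm]

lemma aux_second {m p : ℕ} (U : Set (Fin m → ℂ)) (hU : IsOpen U)
    (φ : (Fin m → ℂ) → Fin p → ℂ) (hφ : ContDiffOn ℝ (⊤ : ℕ∞) φ U)
    (V : Set (Fin p → ℂ)) (hV : IsOpen V) (hUV : Set.MapsTo φ U V)
    (g : (Fin p → ℂ) → ℂ) (hg : DifferentiableOn ℂ g V) (x : Fin m → ℂ) (hx : x ∈ U)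
    (e : Fin m → ℂ) :
    fderiv ℝ (fun y => fderiv ℝ (fun y => g (φ y)) y e) x e =
      ∑ a, ((∑ c, fderiv ℂ (fun z => fderiv ℂ g z (Pi.single a 1)) (φ x) (Pi.single c 1) *
          fderiv ℝ (fun y => φ y c) x e) * fderiv ℝ (fun y => φ y a) x e
        + fderiv ℂ g (φ x) (Pi.single a 1) *
          fderiv ℝ (fun y => fderiv ℝ (fun y => φ y a) y e) x e) := by
  have hφd : ∀ y ∈ U, DifferentiableAt ℝ φ y := fun y hy =>
    (hφ.contDiffAt (hU.mem_nhds hy)).differentiableAt (by simp)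
  have hev : (fun y => fderiv ℝ (fun y => g (φ y)) y e) =ᶠ[nhds x] fun y =>
      ∑ a, fderiv ℂ g (φ y) (Pi.single a 1) * fderiv ℝ (fun y => φ y a) y e :=
    Filter.eventuallyEq_of_mem (hU.mem_nhds hx) fun y hy =>
      aux_chain g φ y (hg.differentiableAt (hV.mem_nhds (hUV hy))) (hφd y hy) e
  rw [hev.fderiv_eq]
  have hA : ∀ a : Fin p, DifferentiableAt ℂ (fun z => fderiv ℂ g z (Pi.single a 1)) (φ x) :=
    fun a => aux_diff V hV g hg (φ x) (hUV hx) _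
  have hA' : ∀ a : Fin p,
      DifferentiableAt ℝ (fun y => fderiv ℂ g (φ y) (Pi.single a 1)) x := fun a =>
    DifferentiableAt.comp (g := fun z => fderiv ℂ g z (Pi.single a 1)) x
      ((hA a).restrictScalars ℝ) (hφd x hx)
  have hB : ∀ a : Fin p, DifferentiableAt ℝ (fun y => fderiv ℝ (fun y => φ y a) y e) x := by
    intro a
    have h1 : ContDiffAt ℝ (⊤ : ℕ∞) (fun y => φ y a) x :=
      contDiffAt_pi.1 (hφ.contDiffAt (hU.mem_nhds hx)) a
    have h2 : ContDiffAt ℝ 1 (fderiv ℝ (fun y => φ y a)) x :=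
      h1.fderiv_right (m := 1) (by
        have h3 : ((2 : ℕ∞) : WithTop ℕ∞) ≤ ((⊤ : ℕ∞) : WithTop ℕ∞) := WithTop.coe_le_coe.2 le_top
        rw [one_add_one_eq_two]
        exact h3)
    exact (h2.differentiableAt (by simp)).clm_apply (differentiableAt_const e)
  rw [fderiv_fun_sum (fun a _ => (hA' a).fun_mul (hB a))]
  rw [_root_.sum_apply]
  refine Finset.sum_congr rfl fun a _ => ?_
  rw [fderiv_fun_mul (hA' a) (hB a)]
  have := aux_chain (fun z => fderiv ℂ g z (Pi.single a 1)) φ x (hA a) (hφd x hx) e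
  rw [← this]
  simp only [_root_.add_apply, _root_.smul_apply, smul_eq_mul]
  ring

lemma aux_conf {m : ℕ} (M : Matrix (Fin m) (Fin m) ℂ) (hM : Mᵀ = -M)
    (R I S T : Fin m → ℂ)
    (h : ∀ i, (R i + Complex.I * I i) / 2 + ∑ j, M j i * ((R j - Complex.I * I j) / 2) = 0)
    (h' : ∀ i, (S i + Complex.I * T i) / 2 + ∑ j, M j i * ((S j - Complex.I * T j) / 2) = 0) :
    ∑ j, (R j * S j + I j * T j) = 0 := by
  have hs : ∀ i j, M i j = - M j i := fun i j => by
    have := congrFun (congrFun hM j) i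
    simpa using this
  have key : ∀ i, R i * S i + I i * T i =
      -2 * (∑ j, M j i * ((R j - Complex.I * I j) / 2) * ((S i - Complex.I * T i) / 2)
        + ∑ j, M j i * ((S j - Complex.I * T j) / 2) * ((R i - Complex.I * I i) / 2)) := by
    intro i
    rw [← Finset.sum_mul, ← Finset.sum_mul, eq_neg_of_add_eq_zero_right (h i),
      eq_neg_of_add_eq_zero_right (h' i)]
    linear_combination (I i * T i) * Complex.I_sq
  simp only [key]
  rw [← Finset.mul_sum, Finset.sum_add_distrib]
  rw [Finset.sum_comm (f := fun i j => M j i * ((S j - Complex.I * T j) / 2) *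
    ((R i - Complex.I * I i) / 2)), ← Finset.sum_add_distrib]
  rw [Finset.sum_eq_zero, mul_zero]
  intro i _
  rw [← Finset.sum_add_distrib]
  refine Finset.sum_eq_zero fun j _ => ?_
  rw [hs i j]
  ring

/-- harmonic `M`-holomorphic maps are closed under postcomposition
with holomorphic maps: if `φ : U → ℂ^p` is smooth, `M`-holomorphic with all
components harmonic, and `f : V → ℂ^q` is holomorphic with `φ(U) ⊆ V`, then
`f ∘ φ` is `M`-holomorphic with all components harmonic. -/
theorem postcomp_holomorphic {m p q : ℕ} (U : Set (Fin m → ℂ)) (hU : IsOpen U)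
    (M : (Fin m → ℂ) → Matrix (Fin m) (Fin m) ℂ)
    (hskew : ∀ x ∈ U, (M x)ᵀ = -(M x))
    (φ : (Fin m → ℂ) → Fin p → ℂ) (hφ : ContDiffOn ℝ (⊤ : ℕ∞) φ U)
    (hhol : ∀ x ∈ U, ∀ i, ∀ a,
      wdqbar (fun y => φ y a) i x + ∑ j, M x j i * wdq (fun y => φ y a) j x = 0)
    (hharm : ∀ x ∈ U, ∀ a, lap (fun y => φ y a) x = 0)
    (V : Set (Fin p → ℂ)) (hV : IsOpen V) (hUV : Set.MapsTo φ U V)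
    (f : (Fin p → ℂ) → Fin q → ℂ) (hf : DifferentiableOn ℂ f V) :
    (∀ x ∈ U, ∀ i, ∀ b,
      wdqbar (fun y => f (φ y) b) i x + ∑ j, M x j i * wdq (fun y => f (φ y) b) j x = 0)
    ∧ (∀ x ∈ U, ∀ b, lap (fun y => f (φ y) b) x = 0) := by
  have hφd : ∀ y ∈ U, DifferentiableAt ℝ φ y := fun y hy =>
    (hφ.contDiffAt (hU.mem_nhds hy)).differentiableAt (by simp)
  have hfb : ∀ b, DifferentiableOn ℂ (fun z => f z b) V := fun b => differentiableOn_pi.1 hf b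
  constructor
  · intro x hx i b
    have hc := aux_chain (fun z => f z b) φ x ((hfb b).differentiableAt (hV.mem_nhds (hUV hx)))
      (hφd x hx)
    have e1 : ∀ j, wdq (fun y => f (φ y) b) j x =
        ∑ a, fderiv ℂ (fun z => f z b) (φ x) (Pi.single a 1) * wdq (fun y => φ y a) j x := by
      intro j
      simp only [wdq, pdRe, pdIm, hc]
      rw [Finset.mul_sum, ← Finset.sum_sub_distrib, Finset.sum_div]
      exact Finset.sum_congr rfl fun a _ => by ring
    have e2 : ∀ j, wdqbar (fun y => f (φ y) b) j x =
        ∑ a, fderiv ℂ (fun z => f z b) (φ x) (Pi.single a 1) * wdqbar (fun y => φ y a) j x := by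
      intro j
      simp only [wdqbar, pdRe, pdIm, hc]
      rw [Finset.mul_sum, ← Finset.sum_add_distrib, Finset.sum_div]
      exact Finset.sum_congr rfl fun a _ => by ring
    simp only [e1, e2, Finset.mul_sum]
    rw [Finset.sum_comm, ← Finset.sum_add_distrib]
    refine Finset.sum_eq_zero fun a _ => ?_
    have := hhol x hx i a
    rw [eq_neg_of_add_eq_zero_left this, mul_neg, Finset.mul_sum, neg_add_eq_zero]
    exact Finset.sum_congr rfl fun j _ => by ring
  · intro x hx b
    have hs := aux_second U hU φ hφ V hV hUV (fun z => f z b) (hfb b) x hx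
    have hconf : ∀ a c, ∑ j, (pdRe (fun y => φ y c) j x * pdRe (fun y => φ y a) j x +
        pdIm (fun y => φ y c) j x * pdIm (fun y => φ y a) j x) = 0 := fun a c =>
      aux_conf (M x) (hskew x hx) _ _ _ _ (fun i => hhol x hx i c) (fun i => hhol x hx i a)
    have hl : ∀ a, lap (fun y => φ y a) x = 0 := hharm x hx
    simp only [lap, pdRe, pdIm] at hl hconf ⊢
    simp only [hs]
    simp only [← Finset.sum_add_distrib]
    rw [Finset.sum_comm]
    refine Finset.sum_eq_zero fun a _ => ?_
    rw [Finset.sum_congr rfl fun j _ => add_add_add_comm _ _ _ _]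
    rw [Finset.sum_add_distrib]
    have z2 := hl a
    simp only [← mul_add, ← Finset.mul_sum, z2, mul_zero, add_zero]
    simp only [Finset.sum_mul, ← Finset.sum_add_distrib]
    rw [Finset.sum_comm]
    refine Finset.sum_eq_zero fun c _ => ?_
    simp only [mul_assoc, ← mul_add, ← Finset.mul_sum, hconf a c, mul_zero]
end

section
/- (Cosymplectic criterion.) Let U ⊆ ℝ^{2m} ≅ ℂ^m be open and let M : U → so(m,ℂ) be a smooth map into the skew-symmetric complex m×m matrices such that each of the functions w^i : U → ℂ, w^i(q) = q^i − Σ_{j=1}^m M^i_{j̄}(q) q̄^j (i = 1,…,m), is M-holomorphic (this expresses integrability of the Hermitian structure J(M) in the large cell). Then the following are equivalent: (a) every smooth M-holomorphic map φ : U' → ℂ defined on an open subset U' ⊆ U is harmonic; (b) each of the functions w^i is harmonic on U; (c) Σ_{j=1}^m ∂M^i_{j̄}/∂q^j = 0 on U for every i = 1,…,m; (d) every point of U has a neighbourhood on which there exist m harmonic M-holomorphic functions whose gradients are linearly independent over ℂ. -/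
open Complex BigOperators Matrix

/-- The complex coordinate functions `w^i(q) = q^i − Σ_j M^i_{j̄}(q) q̄^j` of the
Hermitian structure `J(M)`. -/
noncomputable def wcoord {m : ℕ} (M : (Fin m → ℂ) → Matrix (Fin m) (Fin m) ℂ)
    (i : Fin m) : (Fin m → ℂ) → ℂ :=
  fun q => q i - ∑ j, M q i j * starRingEnd ℂ (q j)


theorem det_ne_zero_of_trace_pow {m : ℕ} (D : Matrix (Fin m) (Fin m) ℂ)
    (h : ∀ n : ℕ, (D ^ n).trace = m) : IsUnit D := by
  have hf : ∀ f : Polynomial ℂ, (Polynomial.aeval D f).trace = m * f.eval 1 := by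
    intro f
    induction f using Polynomial.induction_on' with
    | add p q hp hq => simp [hp, hq, mul_add]
    | monomial n a =>
      simp [Polynomial.aeval_monomial, Algebra.algebraMap_eq_smul_one, h, mul_comm]
  obtain ⟨r, hr, hr2⟩ := Polynomial.exists_eq_pow_rootMultiplicity_mul_and_not_dvd D.charpoly
    D.charpoly_monic.ne_zero 0
  set k := D.charpoly.rootMultiplicity 0
  simp only [map_zero, sub_zero] at hr hr2
  have hcop : IsCoprime ((Polynomial.X : Polynomial ℂ) ^ (k + 1)) r :=
    ((Polynomial.prime_X.irreducible.coprime_iff_not_dvd).2 hr2).pow_left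
  obtain ⟨v, u, huv⟩ := hcop
  have hch : Polynomial.aeval D (Polynomial.X ^ (k + 1) * r) = 0 := by
    rw [pow_succ', mul_assoc, ← hr, map_mul, Matrix.aeval_self_charpoly, mul_zero]
  have h0 : (Polynomial.aeval D (u * r)).trace = 0 := by
    rw [hf]
    have := hf (u * (Polynomial.X ^ (k + 1) * r))
    rw [map_mul, hch] at this
    simpa using this.symm
  have hid : IsIdempotentElem (Polynomial.aeval D (u * r)) := by
    unfold IsIdempotentElem
    rw [← map_mul]
    have : u * r * (u * r) = u * r - u * v * (Polynomial.X ^ (k + 1) * r) := by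
      linear_combination (u * r) * huv
    rw [this, map_sub, map_mul (Polynomial.aeval D) (u * v), hch]; simp
  have he : Polynomial.aeval D (u * r) = 0 := by
    have h1 : IsIdempotentElem (Matrix.toLinAlgEquiv' (Polynomial.aeval D (u * r))) :=
      hid.map _
    have h2 := LinearMap.IsIdempotentElem.eq_zero_of_trace_eq_zero h1 (by
      rw [← h0]; exact Matrix.trace_toLin'_eq _)
    exact (map_eq_zero_iff _ (Matrix.toLinAlgEquiv' (R := ℂ)).injective).1 h2
  have h3 := congrArg (Polynomial.aeval D) huv
  rw [map_add, he, add_zero, map_mul, map_one, pow_succ, map_mul, ← mul_assoc,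
    Polynomial.aeval_X] at h3
  exact ⟨⟨D, _, mul_eq_one_comm.1 h3, h3⟩, rfl⟩

abbrev SmAt {m : ℕ} (f : (Fin m → ℂ) → ℂ) (x : Fin m → ℂ) : Prop :=
  ContDiffAt ℝ (⊤ : ℕ∞) f x

theorem SmAt.diff {m : ℕ} {f : (Fin m → ℂ) → ℂ} {x : Fin m → ℂ} (h : SmAt f x) :
    DifferentiableAt ℝ f x := ContDiffAt.differentiableAt h (by simp)

theorem SmAt.fd {m : ℕ} {f : (Fin m → ℂ) → ℂ} {x : Fin m → ℂ} (h : SmAt f x) :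
    ContDiffAt ℝ (⊤ : ℕ∞) (fderiv ℝ f) x := ContDiffAt.fderiv_right h (by simp)

theorem SmAt.pd {m : ℕ} {f : (Fin m → ℂ) → ℂ} {x : Fin m → ℂ} (h : SmAt f x)
    (v : Fin m → ℂ) : SmAt (fun y => fderiv ℝ f y v) x := h.fd.clm_apply contDiffAt_const

theorem SmAt.wdq {m : ℕ} {f : (Fin m → ℂ) → ℂ} {x : Fin m → ℂ} (h : SmAt f x)
    (j : Fin m) : SmAt (fun y => wdq f j y) x :=
  ((h.pd _).sub (contDiffAt_const.mul (h.pd _))).div_const 2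

theorem SmAt.wdqbar {m : ℕ} {f : (Fin m → ℂ) → ℂ} {x : Fin m → ℂ} (h : SmAt f x)
    (j : Fin m) : SmAt (fun y => wdqbar f j y) x :=
  ((h.pd _).add (contDiffAt_const.mul (h.pd _))).div_const 2

theorem fderiv_pd {m : ℕ} {f : (Fin m → ℂ) → ℂ} {x : Fin m → ℂ} (h : SmAt f x)
    (u v : Fin m → ℂ) :
    fderiv ℝ (fun y => fderiv ℝ f y v) x u = fderiv ℝ (fderiv ℝ f) x u v := by
  rw [fderiv_clm_apply (h.fd.differentiableAt (by simp)) (differentiableAt_const _)]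
  simp

theorem snd_symm {m : ℕ} {f : (Fin m → ℂ) → ℂ} {x : Fin m → ℂ} (h : SmAt f x)
    (u v : Fin m → ℂ) :
    fderiv ℝ (fderiv ℝ f) x u v = fderiv ℝ (fderiv ℝ f) x v u := by
  have h2 : ContDiffAt ℝ 2 f x := h.of_le (WithTop.coe_le_coe.2 le_top)
  exact h2.isSymmSndFDerivAt (by simp) u v

theorem fderiv_wdq {m : ℕ} {f : (Fin m → ℂ) → ℂ} {x : Fin m → ℂ} (h : SmAt f x)
    (j : Fin m) (u : Fin m → ℂ) :
    fderiv ℝ (fun y => wdq f j y) x u = (fderiv ℝ (fderiv ℝ f) x u (Pi.single j 1)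
      - Complex.I * fderiv ℝ (fderiv ℝ f) x u (Pi.single j Complex.I)) / 2 := by
  have h1 := (h.pd (Pi.single j 1)).diff.hasFDerivAt
  have h2 := (h.pd (Pi.single j Complex.I)).diff.hasFDerivAt
  have h3 := ((h1.sub (h2.const_mul Complex.I)).mul_const (2⁻¹ : ℂ)).fderiv
  have h4 : (fun y => wdq f j y) = fun y => (fderiv ℝ f y (Pi.single j 1)
      - Complex.I * fderiv ℝ f y (Pi.single j Complex.I)) * 2⁻¹ := by
    funext y; simp [_root_.wdq, pdRe, pdIm, div_eq_mul_inv]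
  rw [h4]
  refine (DFunLike.congr_fun h3 u).trans ?_
  simp [fderiv_pd h]
  ring

theorem fderiv_wdqbar {m : ℕ} {f : (Fin m → ℂ) → ℂ} {x : Fin m → ℂ} (h : SmAt f x)
    (j : Fin m) (u : Fin m → ℂ) :
    fderiv ℝ (fun y => wdqbar f j y) x u = (fderiv ℝ (fderiv ℝ f) x u (Pi.single j 1)
      + Complex.I * fderiv ℝ (fderiv ℝ f) x u (Pi.single j Complex.I)) / 2 := by
  have h1 := (h.pd (Pi.single j 1)).diff.hasFDerivAt
  have h2 := (h.pd (Pi.single j Complex.I)).diff.hasFDerivAt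
  have h3 := ((h1.add (h2.const_mul Complex.I)).mul_const (2⁻¹ : ℂ)).fderiv
  have h4 : (fun y => wdqbar f j y) = fun y => (fderiv ℝ f y (Pi.single j 1)
      + Complex.I * fderiv ℝ f y (Pi.single j Complex.I)) * 2⁻¹ := by
    funext y; simp [_root_.wdqbar, pdRe, pdIm, div_eq_mul_inv]
  rw [h4]
  refine (DFunLike.congr_fun h3 u).trans ?_
  simp [fderiv_pd h]
  ring

theorem wdq_wdq {m : ℕ} {f : (Fin m → ℂ) → ℂ} {x : Fin m → ℂ} (h : SmAt f x)
    (i j : Fin m) : wdq (fun y => wdq f i y) j x = wdq (fun y => wdq f j y) i x := by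
  rw [wdq, pdRe, pdIm, wdq, pdRe, pdIm]
  simp only [fderiv_wdq h]
  rw [snd_symm h (Pi.single j 1) (Pi.single i 1), snd_symm h (Pi.single j 1) (Pi.single i I),
    snd_symm h (Pi.single j I) (Pi.single i 1), snd_symm h (Pi.single j I) (Pi.single i I)]
  ring

theorem wdq_wdqbar {m : ℕ} {f : (Fin m → ℂ) → ℂ} {x : Fin m → ℂ} (h : SmAt f x)
    (i j : Fin m) : wdq (fun y => wdqbar f i y) j x = wdqbar (fun y => wdq f j y) i x := by
  rw [wdq, pdRe, pdIm, wdqbar, pdRe, pdIm]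
  simp only [fderiv_wdq h, fderiv_wdqbar h]
  rw [snd_symm h (Pi.single j 1) (Pi.single i 1), snd_symm h (Pi.single j 1) (Pi.single i I),
    snd_symm h (Pi.single j I) (Pi.single i 1), snd_symm h (Pi.single j I) (Pi.single i I)]
  ring

theorem lap_eq {m : ℕ} {f : (Fin m → ℂ) → ℂ} {x : Fin m → ℂ} (h : SmAt f x) :
    lap f x = 4 * ∑ i, wdq (fun y => wdqbar f i y) i x := by
  rw [lap, Finset.mul_sum]
  refine Finset.sum_congr rfl fun i _ => ?_
  rw [wdq, pdRe, pdIm, pdRe, pdIm]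
  simp only [fderiv_wdqbar h]
  simp only [pdRe, pdIm, fderiv_pd h]
  rw [snd_symm h (Pi.single i I) (Pi.single i 1)]
  linear_combination ((fderiv ℝ (fderiv ℝ f) x (Pi.single i I)) (Pi.single i I)) * I_mul_I

/-- The functional on real derivatives giving `∂/∂q^j`. -/
noncomputable def Lq {m : ℕ} (j : Fin m) : ((Fin m → ℂ) →L[ℝ] ℂ) →ₗ[ℂ] ℂ where
  toFun A := (A (Pi.single j 1) - Complex.I * A (Pi.single j Complex.I)) / 2
  map_add' A B := by simp; ring
  map_smul' c A := by simp; ring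

/-- The functional on real derivatives giving `∂/∂q̄^j`. -/
noncomputable def Lqb {m : ℕ} (j : Fin m) : ((Fin m → ℂ) →L[ℝ] ℂ) →ₗ[ℂ] ℂ where
  toFun A := (A (Pi.single j 1) + Complex.I * A (Pi.single j Complex.I)) / 2
  map_add' A B := by simp; ring
  map_smul' c A := by simp; ring

theorem wdq_eq {m : ℕ} (f : (Fin m → ℂ) → ℂ) (j : Fin m) (x : Fin m → ℂ) :
    wdq f j x = Lq j (fderiv ℝ f x) := rfl

theorem wdqbar_eq {m : ℕ} (f : (Fin m → ℂ) → ℂ) (j : Fin m) (x : Fin m → ℂ) :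
    wdqbar f j x = Lqb j (fderiv ℝ f x) := rfl

theorem Lfun_mul {m : ℕ} (L : ((Fin m → ℂ) →L[ℝ] ℂ) →ₗ[ℂ] ℂ) {f g : (Fin m → ℂ) → ℂ}
    {x : Fin m → ℂ} (hf : SmAt f x) (hg : SmAt g x) :
    L (fderiv ℝ (fun y => f y * g y) x) = f x * L (fderiv ℝ g x) + L (fderiv ℝ f x) * g x := by
  rw [fderiv_fun_mul hf.diff hg.diff, map_add, map_smul, map_smul]
  simp [mul_comm]

theorem Lfun_sum {m : ℕ} {ι : Type*} (s : Finset ι) (L : ((Fin m → ℂ) →L[ℝ] ℂ) →ₗ[ℂ] ℂ)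
    {f : ι → (Fin m → ℂ) → ℂ}
    {x : Fin m → ℂ} (hf : ∀ i, SmAt (f i) x) :
    L (fderiv ℝ (fun y => ∑ i ∈ s, f i y) x) = ∑ i ∈ s, L (fderiv ℝ (f i) x) := by
  rw [fderiv_fun_sum fun i _ => (hf i).diff, map_sum]

theorem Lfun_congr {m : ℕ} (L : ((Fin m → ℂ) →L[ℝ] ℂ) →ₗ[ℂ] ℂ) {f g : (Fin m → ℂ) → ℂ}
    {U : Set (Fin m → ℂ)} (hU : IsOpen U)
    {x : Fin m → ℂ} (hx : x ∈ U) (h : ∀ y ∈ U, f y = g y) :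
    L (fderiv ℝ f x) = L (fderiv ℝ g x) := by
  rw [Filter.EventuallyEq.fderiv_eq]
  filter_upwards [hU.mem_nhds hx] with y hy using h y hy

/-- entrywise derivative of a matrix function. -/
noncomputable def dM {m : ℕ} (L : ((Fin m → ℂ) →L[ℝ] ℂ) →ₗ[ℂ] ℂ)
    (P : (Fin m → ℂ) → Matrix (Fin m) (Fin m) ℂ) (x : Fin m → ℂ) : Matrix (Fin m) (Fin m) ℂ :=
  Matrix.of fun i j => L (fderiv ℝ (fun y => P y i j) x)

theorem dM_mul {m : ℕ} (L : ((Fin m → ℂ) →L[ℝ] ℂ) →ₗ[ℂ] ℂ)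
    (P Q : (Fin m → ℂ) → Matrix (Fin m) (Fin m) ℂ) (x : Fin m → ℂ)
    (hP : ∀ i j, SmAt (fun y => P y i j) x) (hQ : ∀ i j, SmAt (fun y => Q y i j) x) :
    dM L (fun y => P y * Q y) x = P x * dM L Q x + dM L P x * Q x := by
  ext i j
  simp only [dM, Matrix.of_apply, Matrix.mul_apply, Matrix.add_apply]
  rw [Lfun_sum _ _ fun k => (hP i k).mul (hQ k j), ← Finset.sum_add_distrib]
  exact Finset.sum_congr rfl fun k _ => Lfun_mul L (hP i k) (hQ k j)

theorem sm_mul {m : ℕ}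
    (P Q : (Fin m → ℂ) → Matrix (Fin m) (Fin m) ℂ) (x : Fin m → ℂ)
    (hP : ∀ i j, SmAt (fun y => P y i j) x) (hQ : ∀ i j, SmAt (fun y => Q y i j) x) (i j : Fin m) :
    SmAt (fun y => (P y * Q y) i j) x := by
  simp only [Matrix.mul_apply]
  exact ContDiffAt.sum fun k _ => (hP i k).mul (hQ k j)

theorem sm_pow {m : ℕ}
    (P : (Fin m → ℂ) → Matrix (Fin m) (Fin m) ℂ) (x : Fin m → ℂ)
    (hP : ∀ i j, SmAt (fun y => P y i j) x) (n : ℕ) :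
    ∀ i j, SmAt (fun y => (P y ^ n) i j) x := by
  induction n with
  | zero => intro i j; simp only [pow_zero]; exact contDiffAt_const
  | succ n ih => simp only [pow_succ]; exact sm_mul _ _ x ih hP

theorem tr_dM_pow {m : ℕ} (L : ((Fin m → ℂ) →L[ℝ] ℂ) →ₗ[ℂ] ℂ)
    (P : (Fin m → ℂ) → Matrix (Fin m) (Fin m) ℂ) (x : Fin m → ℂ)
    (hP : ∀ i j, SmAt (fun y => P y i j) x) (n : ℕ) : ∀ k : ℕ,
    (P x ^ k * dM L (fun y => P y ^ (n + 1)) x).trace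
      = (n + 1) * (P x ^ (k + n) * dM L P x).trace := by
  induction n with
  | zero => intro k; simp
  | succ n ih =>
    intro k
    have : dM L (fun y => P y ^ (n + 1 + 1)) x
        = P x ^ (n + 1) * dM L P x + dM L (fun y => P y ^ (n + 1)) x * P x := by
      rw [← dM_mul L _ P x (sm_pow P x hP _) hP]
      simp only [pow_succ]
    rw [this, mul_add, Matrix.trace_add, ← mul_assoc, ← mul_assoc, Matrix.trace_mul_comm _ (P x),
      ← mul_assoc, ← pow_succ', ih, ← pow_add]
    have : k + 1 + n = k + (n + 1) := by ring
    rw [this]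
    push_cast
    ring

theorem tr_dM {m : ℕ} (L : ((Fin m → ℂ) →L[ℝ] ℂ) →ₗ[ℂ] ℂ)
    (P : (Fin m → ℂ) → Matrix (Fin m) (Fin m) ℂ) (x : Fin m → ℂ)
    (hP : ∀ i j, SmAt (fun y => P y i j) x) :
    (dM L P x).trace = L (fderiv ℝ (fun y => (P y).trace) x) := by
  simp only [Matrix.trace, Matrix.diag_apply, dM, Matrix.of_apply]
  rw [Lfun_sum _ _ fun i => hP i i]

/-- The `i`-th `(0,1)`-field of `J(A)` as a functional on derivatives. -/
noncomputable def Lz {m : ℕ} (A : Matrix (Fin m) (Fin m) ℂ) (i : Fin m) :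
    ((Fin m → ℂ) →L[ℝ] ℂ) →ₗ[ℂ] ℂ :=
  Lqb i + ∑ l, A l i • Lq l

theorem Lz_apply {m : ℕ} (A : Matrix (Fin m) (Fin m) ℂ) (i : Fin m)
    (f : (Fin m → ℂ) → ℂ) (x : Fin m → ℂ) :
    Lz A i (fderiv ℝ f x) = wdqbar f i x + ∑ l, A l i * wdq f l x := by
  simp [Lz, wdqbar_eq, wdq_eq]

theorem Lfun_zero {m : ℕ} (L : ((Fin m → ℂ) →L[ℝ] ℂ) →ₗ[ℂ] ℂ) {f : (Fin m → ℂ) → ℂ}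
    {U : Set (Fin m → ℂ)} (hU : IsOpen U)
    {x : Fin m → ℂ} (hx : x ∈ U) (c : ℂ) (h : ∀ y ∈ U, f y = c) :
    L (fderiv ℝ f x) = 0 := by
  rw [Lfun_congr L hU hx h]; simp

theorem Z_wdq {m : ℕ} {U : Set (Fin m → ℂ)} (hU : IsOpen U)
    {M : (Fin m → ℂ) → Matrix (Fin m) (Fin m) ℂ}
    (hM : ∀ i j, ∀ x ∈ U, SmAt (fun q => M q i j) x)
    {φ : (Fin m → ℂ) → ℂ} (hφ : ∀ x ∈ U, SmAt φ x)
    (hol : ∀ q ∈ U, ∀ i, wdqbar φ i q + ∑ j, M q j i * wdq φ j q = 0)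
    (x : Fin m → ℂ) (hx : x ∈ U) (i j : Fin m) :
    wdqbar (fun y => wdq φ j y) i x + ∑ l, M x l i * wdq (fun y => wdq φ j y) l x
      = - ∑ l, wdq φ l x * wdq (fun y => M y l i) j x := by
  have h0 := Lfun_zero (Lq j) hU hx 0 (fun y hy => hol y hy i)
  have hs : ∀ l, SmAt (fun y => M y l i * wdq φ l y) x :=
    fun l => (hM l i x hx).mul ((hφ x hx).wdq l)
  rw [fderiv_fun_add ((hφ x hx).wdqbar i).diff (SmAt.diff (ContDiffAt.sum fun l _ => hs l)),
    map_add, Lfun_sum _ _ hs] at h0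
  have h1 : ∀ l, Lq j (fderiv ℝ (fun y => M y l i * wdq φ l y) x)
      = M x l i * wdq (fun y => wdq φ j y) l x + wdq φ l x * wdq (fun y => M y l i) j x := by
    intro l
    rw [Lfun_mul _ (hM l i x hx) ((hφ x hx).wdq l), ← wdq_eq, ← wdq_eq, wdq_wdq (hφ x hx)]
    ring
  simp only [h1, Finset.sum_add_distrib] at h0
  rw [← wdq_eq, wdq_wdqbar (hφ x hx)] at h0
  linear_combination h0

theorem sum_skew_symm {m : ℕ} (A B : Fin m → Fin m → ℂ) (hA : ∀ i j, A i j = - A j i)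
    (hB : ∀ i j, B i j = B j i) : ∑ i, ∑ j, A i j * B i j = 0 := by
  have h : ∑ i, ∑ j, A i j * B i j = - ∑ i, ∑ j, A i j * B i j := by
    conv_lhs => rw [Finset.sum_comm]
    rw [← Finset.sum_neg_distrib]
    refine Finset.sum_congr rfl fun i _ => ?_
    rw [← Finset.sum_neg_distrib]
    refine Finset.sum_congr rfl fun j _ => ?_
    rw [hA j i, hB j i]; ring
  exact self_eq_neg.1 h

theorem lap_hol {m : ℕ} {U : Set (Fin m → ℂ)} (hU : IsOpen U)
    {M : (Fin m → ℂ) → Matrix (Fin m) (Fin m) ℂ}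
    (hskew : ∀ q ∈ U, (M q)ᵀ = -(M q))
    (hM : ∀ i j, ∀ x ∈ U, SmAt (fun q => M q i j) x)
    {φ : (Fin m → ℂ) → ℂ} (hφ : ∀ x ∈ U, SmAt φ x)
    (hol : ∀ q ∈ U, ∀ i, wdqbar φ i q + ∑ j, M q j i * wdq φ j q = 0)
    (x : Fin m → ℂ) (hx : x ∈ U) :
    lap φ x = -4 * ∑ l, wdq φ l x * ∑ i, wdq (fun y => M y l i) i x := by
  rw [lap_eq (hφ x hx)]
  have h1 : ∀ i, wdq (fun y => wdqbar φ i y) i x =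
      - ∑ l, wdq φ l x * wdq (fun y => M y l i) i x
      - ∑ l, M x l i * wdq (fun y => wdq φ i y) l x := by
    intro i
    rw [wdq_wdqbar (hφ x hx)]
    linear_combination Z_wdq hU hM hφ hol x hx i i
  have h2 : ∑ i, ∑ l, M x l i * wdq (fun y => wdq φ i y) l x = 0 := by
    refine sum_skew_symm (fun i l => M x l i) (fun i l => wdq (fun y => wdq φ i y) l x) ?_ ?_
    · intro i j
      have := congrFun (congrFun (hskew x hx) i) j
      simpa using this
    · intro i j; exact wdq_wdq (hφ x hx) i j
  have h3 : ∀ l, wdq φ l x * ∑ i, wdq (fun y => M y l i) i x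
      = ∑ i, wdq φ l x * wdq (fun y => M y l i) i x := fun l => Finset.mul_sum _ _ _
  simp only [h1, Finset.sum_sub_distrib, h2, Finset.sum_neg_distrib, h3]
  rw [Finset.sum_comm]
  ring

theorem sm_coord {m : ℕ} (i : Fin m) (x : Fin m → ℂ) : SmAt (fun q => q i) x :=
  contDiffAt_apply ℝ ℂ i x

theorem sm_conj {m : ℕ} (i : Fin m) (x : Fin m → ℂ) : SmAt (fun q => starRingEnd ℂ (q i)) x :=
  (Complex.conjCLE.contDiff.contDiffAt).comp x (sm_coord i x)

theorem fd_coord {m : ℕ} (i : Fin m) (x u : Fin m → ℂ) :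
    fderiv ℝ (fun q : Fin m → ℂ => q i) x u = u i := by
  rw [(hasFDerivAt_apply (𝕜 := ℝ) i x).fderiv]; rfl

theorem fd_conj {m : ℕ} (i : Fin m) (x u : Fin m → ℂ) :
    fderiv ℝ (fun q : Fin m → ℂ => starRingEnd ℂ (q i)) x u = starRingEnd ℂ (u i) := by
  have h := (Complex.conjCLE.hasFDerivAt (x := x i)).comp x (hasFDerivAt_apply (𝕜 := ℝ) i x)
  exact DFunLike.congr_fun h.fderiv u

theorem wdq_coord {m : ℕ} (i j : Fin m) (x : Fin m → ℂ) :
    wdq (fun q => q i) j x = (1 : Matrix (Fin m) (Fin m) ℂ) i j := by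
  rw [wdq, pdRe, pdIm, fd_coord, fd_coord, Matrix.one_apply]
  by_cases h : i = j
  · subst h; simp
  · simp [h]

theorem wdq_conj {m : ℕ} (i j : Fin m) (x : Fin m → ℂ) :
    wdq (fun q => starRingEnd ℂ (q i)) j x = 0 := by
  rw [wdq, pdRe, pdIm, fd_conj, fd_conj]
  by_cases h : i = j
  · subst h; simp
  · simp [h]

theorem sm_wcoord {m : ℕ} {M : (Fin m → ℂ) → Matrix (Fin m) (Fin m) ℂ} {x : Fin m → ℂ}
    (hM : ∀ i j, SmAt (fun q => M q i j) x) (i : Fin m) : SmAt (wcoord M i) x :=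
  (sm_coord i x).sub (ContDiffAt.sum fun j _ => (hM i j).mul (sm_conj j x))

theorem wdq_wcoord {m : ℕ} {M : (Fin m → ℂ) → Matrix (Fin m) (Fin m) ℂ} {x : Fin m → ℂ}
    (hM : ∀ i j, SmAt (fun q => M q i j) x) (i j : Fin m) :
    wdq (wcoord M i) j x = (1 : Matrix (Fin m) (Fin m) ℂ) i j
      - ∑ l, wdq (fun y => M y i l) j x * starRingEnd ℂ (x l) := by
  have hs : ∀ l, SmAt (fun y => M y i l * starRingEnd ℂ (y l)) x :=
    fun l => (hM i l).mul (sm_conj l x)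
  rw [wdq_eq]
  unfold wcoord
  rw [fderiv_fun_sub (sm_coord i x).diff (SmAt.diff (ContDiffAt.sum fun l _ => hs l)), map_sub,
    Lfun_sum _ _ hs, ← wdq_eq, wdq_coord]
  congr 1
  refine Finset.sum_congr rfl fun l _ => ?_
  rw [Lfun_mul _ (hM i l) (sm_conj l x), ← wdq_eq, ← wdq_eq, wdq_conj]
  ring

theorem sum_swap3 {m : ℕ} (a : Fin m → ℂ) (B : Matrix (Fin m) (Fin m) ℂ) (c : Fin m → ℂ) :
    ∑ l, (∑ k, a k * B k l) * c l = ∑ k, a k * ∑ l, B k l * c l := by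
  simp only [Finset.sum_mul, Finset.mul_sum]
  rw [Finset.sum_comm]
  simp only [mul_assoc]

theorem D_isUnit {m : ℕ} {U : Set (Fin m → ℂ)} (hU : IsOpen U)
    {M : (Fin m → ℂ) → Matrix (Fin m) (Fin m) ℂ}
    (hskew : ∀ q ∈ U, (M q)ᵀ = -(M q))
    (hM : ∀ i j, ∀ x ∈ U, SmAt (fun q => M q i j) x)
    (hint : ∀ i : Fin m, ∀ q ∈ U, ∀ i',
      wdqbar (wcoord M i) i' q + ∑ j, M q j i' * wdq (wcoord M i) j q = 0)
    (hb : ∀ i : Fin m, ∀ q ∈ U, lap (wcoord M i) q = 0)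
    (x : Fin m → ℂ) (hx : x ∈ U) :
    IsUnit (Matrix.of fun i j => wdq (wcoord M i) j x) := by
  set D : (Fin m → ℂ) → Matrix (Fin m) (Fin m) ℂ :=
    fun y => Matrix.of fun i j => wdq (wcoord M i) j y with hD
  set A : (Fin m → ℂ) → Fin m → Matrix (Fin m) (Fin m) ℂ :=
    fun y i => Matrix.of fun l j => wdq (fun z => M z l i) j y with hA
  have hMx : ∀ y ∈ U, ∀ i j, SmAt (fun q => M q i j) y := fun y hy i j => hM i j y hy
  have hw : ∀ i, ∀ y ∈ U, SmAt (wcoord M i) y := fun i y hy => sm_wcoord (hMx y hy) i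
  have hDs : ∀ y ∈ U, ∀ i j, SmAt (fun z => D z i j) y := fun y hy i j => (hw i y hy).wdq j
  -- contraction with `q̄`
  have hDA : ∀ y ∈ U, D y = 1 - ∑ i, starRingEnd ℂ (y i) • A y i := by
    intro y hy
    ext i j
    simp only [hD, hA, Matrix.of_apply, wdq_wcoord (hMx y hy), Matrix.sub_apply,
      Matrix.sum_apply, Matrix.smul_apply, smul_eq_mul]
    congr 1
    exact Finset.sum_congr rfl fun l _ => mul_comm _ _
  -- `M`-holomorphic derivative of `D`
  have hZ : ∀ y ∈ U, ∀ i, dM (Lz (M y) i) D y = - (D y * A y i) := by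
    intro y hy i
    ext k j
    simp only [dM, Matrix.of_apply, Lz_apply, Matrix.neg_apply, Matrix.mul_apply, hD, hA]
    exact Z_wdq hU hM (hw k) (hint k) y hy i j
  -- skewness of the derivatives
  have hsk : ∀ y ∈ U, ∀ i l j, wdq (fun z => M z i l) j y = - wdq (fun z => M z l i) j y := by
    intro y hy i l j
    have h0 := Lfun_zero (f := fun z => M z i l + M z l i) (Lq j) hU hy 0 (by
      intro z hz
      have := congrFun (congrFun (hskew z hz) i) l
      simp only [Matrix.transpose_apply, Matrix.neg_apply] at this
      rw [this]; ring)
    rw [fderiv_fun_add (hMx y hy i l).diff (hMx y hy l i).diff, map_add, ← wdq_eq, ← wdq_eq] at h0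
    linear_combination h0
  -- trace is `m`
  have htr1 : ∀ y ∈ U, (D y).trace = m := by
    intro y hy
    have hqD : ∀ j, ∑ i, starRingEnd ℂ (y i) * D y i j = starRingEnd ℂ (y j) := by
      intro j
      have h1 : ∀ i, starRingEnd ℂ (y i) * D y i j =
          starRingEnd ℂ (y i) * (1 : Matrix (Fin m) (Fin m) ℂ) i j
          - ∑ l, wdq (fun z => M z i l) j y * (starRingEnd ℂ (y i) * starRingEnd ℂ (y l)) := by
        intro i
        simp only [hD, Matrix.of_apply, wdq_wcoord (hMx y hy), mul_sub, Finset.mul_sum]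
        congr 1
        exact Finset.sum_congr rfl fun l _ => by ring
      simp only [h1, Finset.sum_sub_distrib]
      rw [sum_skew_symm (fun i l => wdq (fun z => M z i l) j y)
        (fun i l => starRingEnd ℂ (y i) * starRingEnd ℂ (y l)) (fun i l => hsk y hy i l j)
        (fun i l => mul_comm _ _)]
      simp [Matrix.one_apply]
    have hc : ∑ l, starRingEnd ℂ (y l) * ∑ i, wdq (fun z => M z l i) i y = 0 := by
      have h1 : ∀ k, ∑ l, D y k l * ∑ i, wdq (fun z => M z l i) i y = 0 := by
        intro k
        have := lap_hol hU hskew hM (hw k) (hint k) y hy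
        rw [hb k y hy] at this
        simpa [hD] using this.symm
      calc _ = ∑ l, (∑ k, starRingEnd ℂ (y k) * D y k l) * ∑ i, wdq (fun z => M z l i) i y := by
            simp only [hqD]
        _ = ∑ k, starRingEnd ℂ (y k) * ∑ l, D y k l * ∑ i, wdq (fun z => M z l i) i y := by
            exact sum_swap3 (fun k => starRingEnd ℂ (y k)) (D y)
              (fun l => ∑ i, wdq (fun z => M z l i) i y)
        _ = 0 := by simp [h1]
    have h2 : (D y).trace = m - ∑ k, ∑ l, wdq (fun z => M z k l) k y * starRingEnd ℂ (y l) := by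
      simp only [Matrix.trace, Matrix.diag_apply, hD, Matrix.of_apply, wdq_wcoord (hMx y hy),
        Finset.sum_sub_distrib]
      simp
    rw [h2, Finset.sum_comm]
    simp only [Finset.mul_sum] at hc
    have h3 : ∑ l, ∑ k, wdq (fun z => M z k l) k y * starRingEnd ℂ (y l) = 0 := by
      rw [← neg_eq_zero, ← hc, ← Finset.sum_neg_distrib]
      refine Finset.sum_congr rfl fun l _ => ?_
      rw [← Finset.sum_neg_distrib]
      refine Finset.sum_congr rfl fun k _ => ?_
      rw [hsk y hy k l k]; ring
    rw [h3, sub_zero]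
  have htr : ∀ n : ℕ, ∀ y ∈ U, (D y ^ (n + 1)).trace = m := by
    intro n
    induction n with
    | zero => simpa using htr1
    | succ n ih =>
      intro y hy
      have h1 : ∀ i, (D y ^ (n + 1) * A y i).trace = 0 := by
        intro i
        have h2 := tr_dM_pow (Lz (M y) i) D y (hDs y hy) n 0
        rw [pow_zero, one_mul, tr_dM _ _ _ (sm_pow D y (hDs y hy) _),
          Lfun_zero _ hU hy _ ih, hZ y hy, zero_add, mul_neg, ← mul_assoc, ← pow_succ,
          Matrix.trace_neg] at h2
        have h3 : (n + 1 : ℂ) ≠ 0 := by exact_mod_cast Nat.succ_ne_zero n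
        simpa [h3] using h2.symm
      rw [pow_succ]
      nth_rewrite 2 [hDA y hy]
      rw [mul_sub, mul_one, Matrix.trace_sub, ih y hy, Finset.mul_sum, Matrix.trace_sum]
      simp [h1]
  refine det_ne_zero_of_trace_pow (D x) fun n => ?_
  cases n with
  | zero => simp
  | succ n => exact htr n x hx

theorem pd_of_hol {m : ℕ} (A : Matrix (Fin m) (Fin m) ℂ) (c : Fin m → ℂ) (F G : Fin m → Fin m → ℂ)
    (hu : LinearIndependent ℂ (fun a : Fin m => (fun j => (F a j, G a j) : Fin m → ℂ × ℂ)))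
    (hol : ∀ a i, (F a i + I * G a i) / 2 + ∑ j, A j i * ((F a j - I * G a j) / 2) = 0)
    (hc : ∀ a, ∑ j, (F a j - I * G a j) / 2 * c j = 0) : c = 0 := by
  set P : Matrix (Fin m) (Fin m) ℂ := Matrix.of fun a j => (F a j - I * G a j) / 2 with hP
  have hli : LinearIndependent ℂ P.row := by
    rw [Fintype.linearIndependent_iff] at hu ⊢
    intro g hg
    apply hu g
    have h1 : ∀ j, ∑ a, g a * ((F a j - I * G a j) / 2) = 0 := by
      intro j
      have := congrFun hg j
      simpa [hP, Finset.sum_apply, Matrix.row] using this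
    have h2 : ∀ j, ∑ a, g a * ((F a j + I * G a j) / 2) = 0 := by
      intro i
      have h3 : ∀ a, (F a i + I * G a i) / 2 = - ∑ j, A j i * ((F a j - I * G a j) / 2) :=
        fun a => by linear_combination hol a i
      simp only [h3, mul_neg, Finset.sum_neg_distrib, Finset.mul_sum]
      rw [Finset.sum_comm, neg_eq_zero]
      refine Finset.sum_eq_zero fun j _ => ?_
      have := congrArg (A j i * ·) (h1 j)
      simp only [Finset.mul_sum, mul_zero] at this
      rw [← this]
      exact Finset.sum_congr rfl fun a _ => by ring
    have h4 : ∀ j, ∑ a, g a * F a j = 0 := by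
      intro j
      have h5 := congrArg₂ (· + ·) (h1 j) (h2 j)
      simp only [← Finset.sum_add_distrib, add_zero] at h5
      rw [← h5]
      exact Finset.sum_congr rfl fun a _ => by ring
    have h6 : ∀ j, ∑ a, g a * G a j = 0 := by
      intro j
      have h5 := congrArg (-I * ·) (congrArg₂ (· - ·) (h2 j) (h1 j))
      simp only [← Finset.sum_sub_distrib, sub_zero, Finset.mul_sum, mul_zero] at h5
      rw [← h5]
      exact Finset.sum_congr rfl fun a _ => by
        linear_combination (g a * G a j) * I_mul_I
    funext j
    have h7 : (∑ a, g a • (fun j => (F a j, G a j) : Fin m → ℂ × ℂ)) j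
        = ∑ a, (g a * F a j, g a * G a j) := by
      simp [Finset.sum_apply]
    rw [h7]
    ext
    · simpa [Prod.fst_sum] using h4 j
    · simpa [Prod.snd_sum] using h6 j
  have hPu : IsUnit P := Matrix.linearIndependent_rows_iff_isUnit.1 hli
  have h8 : P *ᵥ c = 0 := by
    funext a; exact hc a
  exact (Matrix.mulVec_injective_iff_isUnit.2 hPu) (by simpa using h8)

theorem li_of_isUnit {m : ℕ} (F G : Fin m → Fin m → ℂ)
    (hu : IsUnit (Matrix.of fun a j => (F a j - I * G a j) / 2)) :
    LinearIndependent ℂ (fun a : Fin m => (fun j => (F a j, G a j) : Fin m → ℂ × ℂ)) := by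
  have hli := Matrix.linearIndependent_rows_iff_isUnit.2 hu
  rw [Fintype.linearIndependent_iff] at hli ⊢
  intro g hg
  apply hli g
  funext j
  have h7 : ∑ a, (g a * F a j, g a * G a j) = 0 := by
    have := congrFun hg j
    simpa [Finset.sum_apply] using this
  have h4 : ∑ a, g a * F a j = 0 := by simpa [Prod.fst_sum] using congrArg Prod.fst h7
  have h6 : ∑ a, g a * G a j = 0 := by simpa [Prod.snd_sum] using congrArg Prod.snd h7
  have : ∑ a, g a * ((F a j - I * G a j) / 2) = 0 := by
    calc _ = (∑ a, g a * F a j) / 2 - I / 2 * ∑ a, g a * G a j := by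
          rw [Finset.sum_div, Finset.mul_sum, ← Finset.sum_sub_distrib]
          exact Finset.sum_congr rfl fun a _ => by ring
      _ = 0 := by rw [h4, h6]; simp
  simpa [Finset.sum_apply, Matrix.row] using this

/-- cosymplectic criterion: for a smooth skew-symmetric matrix valued
`M` on open `U ⊆ ℂ^m` whose associated coordinates `w^i` are `M`-holomorphic
(integrability), the following are equivalent:
(a) every smooth `M`-holomorphic function on an open subset of `U` is harmonic;
(b) each `w^i` is harmonic on `U`;
(c) `Σ_j ∂M^i_{j̄}/∂q^j = 0` on `U` for each `i`;
(d) locally around each point of `U` there exist `m` harmonic `M`-holomorphic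
functions with pointwise `ℂ`-linearly independent gradients. -/
theorem cosymplectic_criterion {m : ℕ} (U : Set (Fin m → ℂ)) (hU : IsOpen U)
    (M : (Fin m → ℂ) → Matrix (Fin m) (Fin m) ℂ)
    (hskew : ∀ q ∈ U, (M q)ᵀ = -(M q))
    (hM : ∀ i j, ContDiffOn ℝ (⊤ : ℕ∞) (fun q => M q i j) U)
    (hint : ∀ i : Fin m, ∀ q ∈ U, ∀ i',
      wdqbar (wcoord M i) i' q + ∑ j, M q j i' * wdq (wcoord M i) j q = 0) :
    List.TFAE
      [ (∀ U' : Set (Fin m → ℂ), U' ⊆ U → IsOpen U' →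
          ∀ φ : (Fin m → ℂ) → ℂ, ContDiffOn ℝ (⊤ : ℕ∞) φ U' →
            (∀ q ∈ U', ∀ i, wdqbar φ i q + ∑ j, M q j i * wdq φ j q = 0) →
            ∀ q ∈ U', lap φ q = 0),
        (∀ i : Fin m, ∀ q ∈ U, lap (wcoord M i) q = 0),
        (∀ i : Fin m, ∀ q ∈ U, ∑ j, wdq (fun x => M x i j) j q = 0),
        (∀ q ∈ U, ∃ U' : Set (Fin m → ℂ), IsOpen U' ∧ q ∈ U' ∧ U' ⊆ U ∧
          ∃ φ : Fin m → ((Fin m → ℂ) → ℂ),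
            (∀ a, ContDiffOn ℝ (⊤ : ℕ∞) (φ a) U') ∧
            (∀ a, ∀ q' ∈ U', ∀ i,
              wdqbar (φ a) i q' + ∑ j, M q' j i * wdq (φ a) j q' = 0) ∧
            (∀ a, ∀ q' ∈ U', lap (φ a) q' = 0) ∧
            (∀ q' ∈ U', LinearIndependent ℂ
              (fun a : Fin m => (fun j => (pdRe (φ a) j q', pdIm (φ a) j q') : Fin m → ℂ × ℂ)))) ] := by
  have hMs : ∀ i j, ∀ x ∈ U, SmAt (fun q => M q i j) x :=
    fun i j x hx => (hM i j).contDiffAt (hU.mem_nhds hx)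
  have hws : ∀ i, ∀ x ∈ U, SmAt (wcoord M i) x :=
    fun i x hx => sm_wcoord (fun i j => hMs i j x hx) i
  tfae_have 3 → 1 := by
    intro hc U' hU' hopen φ hφ hol q hq
    have hφs : ∀ x ∈ U', SmAt φ x := fun x hx => hφ.contDiffAt (hopen.mem_nhds hx)
    rw [lap_hol hopen (fun q hq => hskew q (hU' hq)) (fun i j x hx => hMs i j x (hU' hx))
      hφs hol q hq]
    simp [hc _ q (hU' hq)]
  tfae_have 1 → 2 := by
    intro ha i q hq
    exact ha U subset_rfl hU (wcoord M i) (fun x hx => (hws i x hx).contDiffWithinAt)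
      (hint i) q hq
  tfae_have 2 → 4 := by
    intro hb q hq
    refine ⟨U, hU, hq, subset_rfl, wcoord M, fun a x hx => (hws a x hx).contDiffWithinAt,
      hint, hb, fun x hx => ?_⟩
    exact li_of_isUnit _ _ (D_isUnit hU hskew hMs hint hb x hx)
  tfae_have 4 → 3 := by
    intro hd i q hq
    obtain ⟨U', hopen, hqU, hsub, φ, hφ, hol, hlap, hli⟩ := hd q hq
    have h := pd_of_hol (M q) (fun i => ∑ j, wdq (fun x => M x i j) j q)
      (fun a j => pdRe (φ a) j q) (fun a j => pdIm (φ a) j q) (hli q hqU)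
      (fun a i => hol a q hqU i) (fun a => by
        have h1 := lap_hol hopen (fun q hq => hskew q (hsub hq))
          (fun i j x hx => hMs i j x (hsub hx))
          (fun x hx => (hφ a).contDiffAt (hopen.mem_nhds hx)) (hol a) q hqU
        rw [hlap a q hqU] at h1
        have h2 := mul_eq_zero.1 h1.symm
        exact h2.resolve_left (by norm_num))
    exact congrFun h i
  tfae_finish
end

section
/- (Implicitly defined holomorphic maps.) Let W ⊆ ℂ^m × ℂ^k and V ⊆ ℂ^k be open, let f : W → ℂ^k and M : V → so(m,ℂ) be holomorphic, and define F(q,z) = f(q − M(z)q̄, z) on A = {(q,z) : z ∈ V, (q − M(z)q̄, z) ∈ W}, where q̄ denotes the componentwise conjugate of q ∈ ℂ^m. Let z : U → V be a smooth map on an open set U ⊆ ℂ^m with (q, z(q)) ∈ A and F(q, z(q)) = 0 for all q ∈ U, and such that the k×k matrix K(q) = (∂F^a/∂z^b)(q, z(q)) is invertible for every q ∈ U. Then: (i) z is (M∘z)-holomorphic, i.e. ∂z^a/∂q̄^i + Σ_j M^j_{ī}(z(q)) ∂z^a/∂q^j = 0 for all i and a; (ii) ∂z^a/∂q^i = A^a_i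 where A^a_i := −Σ_b (K^{-1})^a_b (∂f^b/∂w^i)(q − M(z(q))q̄, z(q)); and (iii) (1/4)Δz^a = − Σ_{i,j=1}^m Σ_{b=1}^k A^a_i A^b_j (∂M^i_{j̄}/∂z^b)(z(q)) for each a = 1,…,k. -/
open Complex BigOperators Matrix

/-- First-order identity: the real differential of the solution factors through `v - M v̄`. -/
theorem first_order {m k : ℕ}
    (W : Set ((Fin m → ℂ) × (Fin k → ℂ))) (hW : IsOpen W)
    (V : Set (Fin k → ℂ)) (hV : IsOpen V)
    (f : (Fin m → ℂ) × (Fin k → ℂ) → Fin k → ℂ) (hf : DifferentiableOn ℂ f W)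
    (M : (Fin k → ℂ) → Matrix (Fin m) (Fin m) ℂ)
    (hM : ∀ i j, DifferentiableOn ℂ (fun w => M w i j) V)
    (F : (Fin m → ℂ) → (Fin k → ℂ) → Fin k → ℂ)
    (hF : ∀ q z, F q z = f (q - (M z).mulVec (fun i => starRingEnd ℂ (q i)), z))
    (U : Set (Fin m → ℂ)) (hU : IsOpen U)
    (z : (Fin m → ℂ) → Fin k → ℂ) (hz : DifferentiableOn ℝ z U)
    (hzV : Set.MapsTo z U V)
    (hmem : ∀ q ∈ U, (q - (M (z q)).mulVec (fun i => starRingEnd ℂ (q i)), z q) ∈ W)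
    (hsol : ∀ q ∈ U, F q (z q) = 0)
    (K : (Fin m → ℂ) → Matrix (Fin k) (Fin k) ℂ)
    (hK : ∀ q, ∀ a b, K q a b = fderiv ℂ (fun zz => F q zz a) (z q) (Pi.single b 1))
    (hKdet : ∀ q ∈ U, (K q).det ≠ 0)
    (A : (Fin m → ℂ) → Fin k → Fin m → ℂ)
    (hA : ∀ q a i, A q a i = - ∑ b, (K q)⁻¹ a b *
        fderiv ℂ (fun p => f p b)
          (q - (M (z q)).mulVec (fun i => starRingEnd ℂ (q i)), z q)
          (Pi.single i 1, 0))
    (q : Fin m → ℂ) (hq : q ∈ U) (v : Fin m → ℂ) (a : Fin k) :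
    fderiv ℝ z q v a
      = ∑ i, A q a i * (v i - (M (z q)).mulVec (fun i => starRingEnd ℂ (v i)) i) := by
  have hzq : HasFDerivAt z (fderiv ℝ z q) q :=
    ((hz q hq).differentiableAt (hU.mem_nhds hq)).hasFDerivAt
  set D := fderiv ℝ z q with hD
  have hN : ∀ i j, HasFDerivAt (fun w => M w i j) (fderiv ℂ (fun w => M w i j) (z q)) (z q) :=
    fun i j => ((hM i j _ (hzV hq)).differentiableAt (hV.mem_nhds (hzV hq))).hasFDerivAt
  set N := fun i j => fderiv ℂ (fun w => M w i j) (z q) with hNdef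
  set p := (q - (M (z q)).mulVec (fun i => starRingEnd ℂ (q i)), z q) with hp
  have hfp : HasFDerivAt f (fderiv ℂ f p) p :=
    ((hf p (hmem q hq)).differentiableAt (hW.mem_nhds (hmem q hq))).hasFDerivAt
  set L := fderiv ℂ f p with hL
  have hLb : ∀ b, fderiv ℂ (fun p => f p b) p = (ContinuousLinearMap.proj b).comp L := by
    intro b
    exact (hasFDerivAt_pi'.1 hfp b).fderiv
  -- the derivative in the second variable
  let P : (Fin k → ℂ) →L[ℂ] (Fin m → ℂ) × (Fin k → ℂ) :=
    (-(ContinuousLinearMap.pi fun i => ∑ j, (starRingEnd ℂ (q j)) • N i j)).prod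
      (ContinuousLinearMap.id ℂ _)
  have hP : HasFDerivAt
      (fun zz => (q - (M zz).mulVec (fun i => starRingEnd ℂ (q i)), zz)) P (z q) := by
    refine HasFDerivAt.prodMk ?_ (hasFDerivAt_id _)
    have hs : HasFDerivAt (fun zz => (M zz).mulVec (fun i => starRingEnd ℂ (q i)))
        (ContinuousLinearMap.pi fun i => ∑ j, (starRingEnd ℂ (q j)) • N i j) (z q) := by
      rw [hasFDerivAt_pi]
      intro i
      simp only [Matrix.mulVec, dotProduct]
      exact HasFDerivAt.fun_sum fun j _ => (hN i j).mul_const _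
    exact hs.const_sub _
  have hKL : ∀ x a, (K q *ᵥ x) a = L (P x) a := by
    intro x a
    have h1 : ∀ b, K q a b = L (P (Pi.single b 1)) a := by
      intro b
      rw [hK]
      have : (fun zz => F q zz a) = fun zz =>
          f (q - (M zz).mulVec (fun i => starRingEnd ℂ (q i)), zz) a := by
        funext zz; rw [hF]
      rw [this]
      have h2 := hasFDerivAt_pi'.1 (HasFDerivAt.comp
        (f := fun zz => (q - (M zz).mulVec (fun i => starRingEnd ℂ (q i)), zz)) (z q) hfp hP) a
      exact congrArg (fun T => T (Pi.single b 1)) h2.fderiv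
    have h3 : x = ∑ b, x b • (Pi.single b (1:ℂ) : Fin k → ℂ) := by
      exact pi_eq_sum_univ' x
    conv_rhs => rw [h3]
    simp only [map_sum, map_smul, Finset.sum_apply, Pi.smul_apply, Matrix.mulVec, dotProduct, h1,
      smul_eq_mul]
    exact Finset.sum_congr rfl fun _ _ => mul_comm _ _
  -- the real derivative of the inner map
  let cj : (Fin m) → (Fin m → ℂ) →L[ℝ] ℂ := fun j =>
    (Complex.conjCLE : ℂ →L[ℝ] ℂ).comp (ContinuousLinearMap.proj j)
  have hcj : ∀ j, HasFDerivAt (fun x : Fin m → ℂ => starRingEnd ℂ (x j)) (cj j) q := by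
    intro j
    exact (cj j).hasFDerivAt
  have hNR : ∀ i j, HasFDerivAt (fun x => M (z x) i j) (((N i j).restrictScalars ℝ).comp D) q :=
    fun i j => HasFDerivAt.comp q ((hN i j).restrictScalars ℝ) hzq
  let Q : (Fin m → ℂ) →L[ℝ] (Fin m → ℂ) × (Fin k → ℂ) :=
    (ContinuousLinearMap.id ℝ _ - (ContinuousLinearMap.pi fun i => ∑ j,
      (M (z q) i j • cj j + (starRingEnd ℂ (q j)) • (((N i j).restrictScalars ℝ).comp D)))).prod D
  have hQ : HasFDerivAt
      (fun x => (x - (M (z x)).mulVec (fun i => starRingEnd ℂ (x i)), z x)) Q q := by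
    refine HasFDerivAt.prodMk ?_ hzq
    refine HasFDerivAt.sub (hasFDerivAt_id _) ?_
    rw [hasFDerivAt_pi]
    intro i
    simp only [Matrix.mulVec, dotProduct]
    exact HasFDerivAt.fun_sum fun j _ => (hNR i j).mul (hcj j)
  set u : Fin m → ℂ := fun i => v i - (M (z q)).mulVec (fun i => starRingEnd ℂ (v i)) i with hu
  have hQv : Q v = (u, 0) + P (D v) := by
    refine Prod.ext ?_ ?_
    · funext i
      simp [Q, P, hu, cj, Matrix.mulVec, dotProduct, Finset.sum_add_distrib]
      ring
    · simp [Q, P]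
  have hzero : L (Q v) = 0 := by
    have h1 : HasFDerivAt (fun x => f (x - (M (z x)).mulVec (fun i => starRingEnd ℂ (x i)), z x))
        ((L.restrictScalars ℝ).comp Q) q :=
      HasFDerivAt.comp (f := fun x => (x - (M (z x)).mulVec (fun i => starRingEnd ℂ (x i)), z x))
        q (hfp.restrictScalars ℝ) hQ
    have h2 : (fun x => f (x - (M (z x)).mulVec (fun i => starRingEnd ℂ (x i)), z x))
        =ᶠ[nhds q] fun _ => (0 : Fin k → ℂ) := by
      filter_upwards [hU.mem_nhds hq] with x hx
      rw [← hF, hsol x hx]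
    have h3 := h1.unique ((hasFDerivAt_const (0 : Fin k → ℂ) q).congr_of_eventuallyEq h2)
    exact congrArg (fun T => T v) h3
  have hmain : K q *ᵥ (D v) = - L (u, 0) := by
    funext a
    rw [hKL]
    rw [hQv, map_add] at hzero
    have := congrFun hzero a
    simp only [Pi.add_apply, Pi.zero_apply] at this
    simp only [Pi.neg_apply]
    linear_combination this
  have hinv : D v = (K q)⁻¹ *ᵥ (- L (u, 0)) := by
    rw [← hmain, Matrix.mulVec_mulVec, Matrix.nonsing_inv_mul _ (isUnit_iff_ne_zero.2 (hKdet q hq)),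
      Matrix.one_mulVec]
  have hLu : ∀ b, L (u, 0) b = ∑ i, u i * L (Pi.single i 1, 0) b := by
    intro b
    have h3 : (u, (0 : Fin k → ℂ)) = ∑ i, u i • ((Pi.single i (1:ℂ) : Fin m → ℂ), (0 : Fin k → ℂ)) := by
      refine Prod.ext ?_ ?_
      · rw [Prod.fst_sum]; exact pi_eq_sum_univ' u
      · rw [Prod.snd_sum]; simp
    rw [h3]
    simp only [map_sum, map_smul, Finset.sum_apply, Pi.smul_apply, smul_eq_mul]
  rw [hinv]
  simp only [Matrix.mulVec, dotProduct, Pi.neg_apply, hLu]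
  have : ∀ i, A q a i = - ∑ b, (K q)⁻¹ a b * L (Pi.single i 1, 0) b := by
    intro i
    rw [hA]
    simp only [← hp, hLb]
    rfl
  change _ = ∑ i, A q a i * u i
  simp only [this, Finset.mul_sum, neg_mul, mul_neg, Finset.sum_mul, Finset.sum_neg_distrib]
  rw [Finset.sum_comm]
  congr 1
  refine Finset.sum_congr rfl fun _ _ => Finset.sum_congr rfl fun _ _ => by ring

/-- implicitly defined holomorphic maps: if `z : U → V` is a smooth
solution of `F(q, z(q)) = 0` where `F(q,z) = f(q − M(z)q̄, z)` with `f, M`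
holomorphic and the Jacobian `K = (∂F^a/∂z^b)` invertible along `z`, then
(i) `z` is `(M∘z)`-holomorphic; (ii) `∂z^a/∂q^i = A^a_i` where
`A^a_i = −Σ_b (K⁻¹)^a_b ∂f^b/∂w^i`; (iii)
`(1/4)Δz^a = −Σ_{i,j,b} A^a_i A^b_j (∂M^i_{j̄}/∂z^b)(z(q))`. -/
theorem implicit_holomorphic_maps {m k : ℕ}
    (W : Set ((Fin m → ℂ) × (Fin k → ℂ))) (hW : IsOpen W)
    (V : Set (Fin k → ℂ)) (hV : IsOpen V)
    (f : (Fin m → ℂ) × (Fin k → ℂ) → Fin k → ℂ) (hf : DifferentiableOn ℂ f W)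
    (M : (Fin k → ℂ) → Matrix (Fin m) (Fin m) ℂ)
    (hskew : ∀ v ∈ V, (M v)ᵀ = -(M v))
    (hM : ∀ i j, DifferentiableOn ℂ (fun w => M w i j) V)
    (F : (Fin m → ℂ) → (Fin k → ℂ) → Fin k → ℂ)
    (hF : ∀ q z, F q z = f (q - (M z).mulVec (fun i => starRingEnd ℂ (q i)), z))
    (U : Set (Fin m → ℂ)) (hU : IsOpen U)
    (z : (Fin m → ℂ) → Fin k → ℂ) (hz : ContDiffOn ℝ (⊤ : ℕ∞) z U)
    (hzV : Set.MapsTo z U V)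
    (hmem : ∀ q ∈ U, (q - (M (z q)).mulVec (fun i => starRingEnd ℂ (q i)), z q) ∈ W)
    (hsol : ∀ q ∈ U, F q (z q) = 0)
    (K : (Fin m → ℂ) → Matrix (Fin k) (Fin k) ℂ)
    (hK : ∀ q, ∀ a b, K q a b = fderiv ℂ (fun zz => F q zz a) (z q) (Pi.single b 1))
    (hKdet : ∀ q ∈ U, (K q).det ≠ 0)
    (A : (Fin m → ℂ) → Fin k → Fin m → ℂ)
    (hA : ∀ q a i, A q a i = - ∑ b, (K q)⁻¹ a b *
        fderiv ℂ (fun p => f p b)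
          (q - (M (z q)).mulVec (fun i => starRingEnd ℂ (q i)), z q)
          (Pi.single i 1, 0)) :
    (∀ q ∈ U, ∀ i, ∀ a,
        wdqbar (fun x => z x a) i q + ∑ j, M (z q) j i * wdq (fun x => z x a) j q = 0)
    ∧ (∀ q ∈ U, ∀ a, ∀ i, wdq (fun x => z x a) i q = A q a i)
    ∧ (∀ q ∈ U, ∀ a, (1/4 : ℂ) * lap (fun x => z x a) q
        = - ∑ i, ∑ j, ∑ b, A q a i * A q b j *
            fderiv ℂ (fun w => M w i j) (z q) (Pi.single b 1)) := by
  have hzd : DifferentiableOn ℝ z U := hz.differentiableOn (by simp)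
  have key := first_order W hW V hV f hf M hM F hF U hU z hzd hzV hmem hsol K hK hKdet A hA
  have hcomp : ∀ q ∈ U, ∀ a v, fderiv ℝ (fun x => z x a) q v = fderiv ℝ z q v a := by
    intro q hq a v
    have h := ((hzd q hq).differentiableAt (hU.mem_nhds hq)).hasFDerivAt
    exact congrArg (fun T => T v) (hasFDerivAt_pi'.1 h a).fderiv
  have hre : ∀ q ∈ U, ∀ a i, pdRe (fun x => z x a) i q
      = A q a i - ∑ j, M (z q) j i * A q a j := by
    intro q hq a i
    rw [pdRe, hcomp q hq, key q hq]
    have h1 : ∀ j, (starRingEnd ℂ) ((Pi.single i (1:ℂ) : Fin m → ℂ) j)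
        = (Pi.single i (1:ℂ) : Fin m → ℂ) j := by
      intro j
      by_cases h : j = i
      · subst h; simp
      · simp [h]
    simp only [h1, Matrix.mulVec_single_one, mul_sub, Finset.sum_sub_distrib]
    congr 1
    · simp [Pi.single_apply]
    · exact Finset.sum_congr rfl fun _ _ => mul_comm _ _
  have him : ∀ q ∈ U, ∀ a i, pdIm (fun x => z x a) i q
      = Complex.I * (A q a i + ∑ j, M (z q) j i * A q a j) := by
    intro q hq a i
    rw [pdIm, hcomp q hq, key q hq]
    have h1 : ∀ j, (starRingEnd ℂ) ((Pi.single i Complex.I : Fin m → ℂ) j)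
        = (Pi.single i (-Complex.I) : Fin m → ℂ) j := by
      intro j
      by_cases h : j = i
      · subst h; simp
      · simp [h]
    simp only [h1, Matrix.mulVec_single, mul_sub, Finset.sum_sub_distrib, mul_add, Finset.mul_sum]
    rw [sub_eq_add_neg, ← Finset.sum_neg_distrib]
    congr 1
    · simp [Pi.single_apply, mul_comm]
    · refine Finset.sum_congr rfl fun _ _ => ?_
      simp
      ring
  have hq1 : ∀ q ∈ U, ∀ a, ∀ i, wdq (fun x => z x a) i q = A q a i := by
    intro q hq a i
    rw [wdq, hre q hq, him q hq]
    linear_combination (-(A q a i + ∑ j, M (z q) j i * A q a j) / 2) * Complex.I_mul_I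
  have hq2 : ∀ q ∈ U, ∀ i, ∀ a,
        wdqbar (fun x => z x a) i q + ∑ j, M (z q) j i * wdq (fun x => z x a) j q = 0 := by
    intro q hq i a
    simp only [hq1 q hq]
    rw [wdqbar, hre q hq, him q hq]
    linear_combination ((A q a i + ∑ j, M (z q) j i * A q a j) / 2) * Complex.I_mul_I
  refine ⟨hq2, hq1, ?_⟩
  intro q hq a
  have hza : ContDiffAt ℝ (⊤ : ℕ∞) (fun x => z x a) q :=
    contDiffAt_pi.1 (hz.contDiffAt (hU.mem_nhds hq)) a
  have hd : DifferentiableAt ℝ (fderiv ℝ (fun x => z x a)) q :=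
    (hza.fderiv_right (m := 1) (by norm_cast)).differentiableAt (by simp)
  set H := fderiv ℝ (fderiv ℝ (fun x => z x a)) q with hH
  have hsym : ∀ v w, H v w = H w v := by
    have : IsSymmSndFDerivAt ℝ (fun x => z x a) q :=
      hza.isSymmSndFDerivAt (by simp; norm_cast)
    exact fun v w => this v w
  have hdir : ∀ w, HasFDerivAt (fun x => fderiv ℝ (fun x => z x a) x w) (H.flip w) q := by
    intro w
    have := hd.hasFDerivAt.clm_apply (hasFDerivAt_const w q)
    rw [ContinuousLinearMap.comp_zero, zero_add] at this
    exact this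
  let e : Fin m → Fin m → ℂ := fun j => Pi.single j 1
  let eim : Fin m → Fin m → ℂ := fun j => Pi.single j Complex.I
  have hlap : lap (fun x => z x a) q = ∑ j, (H (e j) (e j) + H (eim j) (eim j)) := by
    unfold lap
    refine Finset.sum_congr rfl fun j _ => ?_
    congr 1
    · exact congrArg (fun T => T (e j)) (hdir (e j)).fderiv
    · exact congrArg (fun T => T (eim j)) (hdir (eim j)).fderiv
  have hwq : ∀ j, HasFDerivAt (fun x => wdq (fun x => z x a) j x)
      ((1/2 : ℂ) • (H.flip (e j) - Complex.I • H.flip (eim j))) q := by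
    intro j
    have := ((hdir (e j)).sub ((hdir (eim j)).const_mul Complex.I)).const_mul (1/2 : ℂ)
    refine this.congr_of_eventuallyEq (Filter.Eventually.of_forall fun x => ?_)
    simp only [wdq, pdRe, pdIm, e, eim, Pi.sub_apply]
    ring
  have hwqb : ∀ j, HasFDerivAt (fun x => wdqbar (fun x => z x a) j x)
      ((1/2 : ℂ) • (H.flip (e j) + Complex.I • H.flip (eim j))) q := by
    intro j
    have := ((hdir (e j)).add ((hdir (eim j)).const_mul Complex.I)).const_mul (1/2 : ℂ)
    refine this.congr_of_eventuallyEq (Filter.Eventually.of_forall fun x => ?_)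
    simp only [wdqbar, pdRe, pdIm, e, eim, Pi.add_apply]
    ring
  have hN : ∀ i j, HasFDerivAt (fun w => M w i j) (fderiv ℂ (fun w => M w i j) (z q)) (z q) :=
    fun i j => ((hM i j _ (hzV hq)).differentiableAt (hV.mem_nhds (hzV hq))).hasFDerivAt
  set N := fun i j => fderiv ℂ (fun w => M w i j) (z q) with hNdef
  have hzq : HasFDerivAt z (fderiv ℝ z q) q :=
    ((hzd q hq).differentiableAt (hU.mem_nhds hq)).hasFDerivAt
  set D := fderiv ℝ z q with hD
  have hNR : ∀ i j, HasFDerivAt (fun x => M (z x) i j) (((N i j).restrictScalars ℝ).comp D) q :=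
    fun i j => HasFDerivAt.comp q ((hN i j).restrictScalars ℝ) hzq
  have hid : ∀ i v, (1/2 : ℂ) * (H v (e i) + Complex.I * H v (eim i))
      + ∑ j, (M (z q) j i * ((1/2 : ℂ) * (H v (e j) - Complex.I * H v (eim j)))
        + A q a j * N j i (D v)) = 0 := by
    intro i v
    have h1 := (hwqb i).add (HasFDerivAt.fun_sum (u := Finset.univ)
      fun j _ => (hNR j i).mul (hwq j))
    have h2 : (fun x => wdqbar (fun x => z x a) i x
        + ∑ j, M (z x) j i * wdq (fun x => z x a) j x) =ᶠ[nhds q] fun _ => (0 : ℂ) := by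
      filter_upwards [hU.mem_nhds hq] with x hx
      exact hq2 x hx i a
    have h3 := h1.unique ((hasFDerivAt_const (0 : ℂ) q).congr_of_eventuallyEq h2)
    have h4 := congrArg (fun T => T v) h3
    simpa [hq1 q hq, mul_add] using h4
  have hDA : ∀ i j l, (1/2 : ℂ) * (N j l (D (e i)) - Complex.I * N j l (D (eim i)))
      = ∑ b, A q b i * N j l (Pi.single b 1) := by
    intro i j l
    have h1 : (1/2 : ℂ) • (D (e i) - Complex.I • D (eim i))
        = ∑ b, A q b i • (Pi.single b (1:ℂ) : Fin k → ℂ) := by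
      have h0 : (1/2 : ℂ) • (D (e i) - Complex.I • D (eim i)) = fun b => A q b i := by
        funext b
        rw [← hq1 q hq b i, wdq, pdRe, pdIm, hcomp q hq, hcomp q hq]
        simp only [Pi.smul_apply, Pi.sub_apply, smul_eq_mul, e, eim, hD]
        ring
      rw [h0]
      exact pi_eq_sum_univ' _
    have h2 := congrArg (N j l) h1
    simpa only [map_smul, map_sub, map_sum, smul_eq_mul] using h2
  -- combine
  let S : Fin m → Fin m → ℂ := fun i j => (1/4 : ℂ) *
    (H (e i) (e j) - Complex.I * H (e i) (eim j) - Complex.I * H (eim i) (e j)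
      - H (eim i) (eim j))
  have hS : ∀ i j, S i j = S j i := by
    intro i j
    simp only [S]
    rw [hsym (e i) (e j), hsym (e i) (eim j), hsym (eim i) (e j), hsym (eim i) (eim j)]
    ring
  have hMs : ∀ i j, M (z q) j i = - M (z q) i j := by
    intro i j
    exact congrFun (congrFun (hskew _ (hzV hq)) i) j
  have hMS : ∑ i, ∑ j, M (z q) j i * S i j = 0 := by
    have h : ∑ i, ∑ j, M (z q) j i * S i j = - ∑ i, ∑ j, M (z q) j i * S i j := by
      conv_lhs => rw [Finset.sum_comm]
      rw [← Finset.sum_neg_distrib]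
      refine Finset.sum_congr rfl fun i _ => ?_
      rw [← Finset.sum_neg_distrib]
      refine Finset.sum_congr rfl fun j _ => ?_
      rw [hMs j i, hS i j, hMs i j]
      ring
    exact self_eq_neg.1 h
  have hterm : ∀ i, (1/4 : ℂ) * (H (e i) (e i) + H (eim i) (eim i))
      = - ∑ j, M (z q) j i * S i j
        - ∑ j, ∑ b, A q a j * A q b i * N j i (Pi.single b 1) := by
    intro i
    have h1 := hid i (e i)
    have h2 := hid i (eim i)
    have h3 : ∑ j, ∑ b, A q a j * A q b i * N j i (Pi.single b 1)
        = ∑ j, A q a j * ((1/2 : ℂ) * (N j i (D (e i)) - Complex.I * N j i (D (eim i)))) := by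
      refine Finset.sum_congr rfl fun j _ => ?_
      rw [hDA, Finset.mul_sum]
      exact Finset.sum_congr rfl fun b _ => by ring
    have h4 : ∑ j, M (z q) j i * S i j
        + ∑ j, A q a j * ((1/2 : ℂ) * (N j i (D (e i)) - Complex.I * N j i (D (eim i))))
        = (1/2 : ℂ) * ∑ j, (M (z q) j i * ((1/2 : ℂ) * (H (e i) (e j) - Complex.I * H (e i) (eim j)))
          + A q a j * N j i (D (e i)))
        - (Complex.I / 2) * ∑ j, (M (z q) j i * ((1/2 : ℂ) *
            (H (eim i) (e j) - Complex.I * H (eim i) (eim j))) + A q a j * N j i (D (eim i))) := by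
      rw [Finset.mul_sum, Finset.mul_sum, ← Finset.sum_add_distrib, ← Finset.sum_sub_distrib]
      refine Finset.sum_congr rfl fun j _ => ?_
      simp only [S]
      linear_combination (-(M (z q) j i) * H (eim i) (eim j) / 4) * Complex.I_mul_I
    rw [h3]
    have h5 := hsym (e i) (eim i)
    linear_combination (1/2 : ℂ) * h1 - (Complex.I / 2) * h2 + h4 - (Complex.I / 4) * h5
      + (H (eim i) (eim i) / 4) * Complex.I_mul_I
  rw [hlap, Finset.mul_sum, Finset.sum_congr rfl fun i _ => hterm i, Finset.sum_sub_distrib,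
    Finset.sum_neg_distrib, hMS, neg_zero, zero_sub, Finset.sum_comm]
end

section
/- (Global examples in odd dimensions.) For every m ≥ 3 there exists a smooth map ψ : ℝ^{2m−1} → ℂ, defined on all of ℝ^{2m−1}, such that: (1) Δψ = 0; (2) Σ_{i=1}^{2m−1} (∂ψ/∂x^i)² = 0 (so ψ is a harmonic morphism); (3) ψ is a submersion; (4) ψ is full, i.e. for every nonzero v ∈ ℝ^{2m−1} the directional derivative ∂_v ψ does not vanish identically; and (5) the trivial extension Φ : ℝ^{2m} → ℂ, Φ(x^1, x^2, …, x^{2m}) := ψ(x^2, …, x^{2m}), is not holomorphic with respect to any Kähler structure: there is no linear isometry J : ℝ^{2m} → ℝ^{2m} with J² = −Id such that dΦ_x(Jv) = i·dΦ_x(v) for all x and v. (Hence ψ does not arise from a Kähler structure.) -/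
open Complex BigOperators

/-- Partial derivative `∂f/∂x^i` of a complex-valued map on `ℝ^n`. -/
noncomputable def pd {n : ℕ} (f : (Fin n → ℝ) → ℂ) (i : Fin n) (x : Fin n → ℝ) : ℂ :=
  fderiv ℝ f x (Pi.single i 1)

/-- Laplacian `Δf = Σ_{i=1}^n ∂²f/(∂x^i)²` on `ℝ^n`. -/
noncomputable def lapR {n : ℕ} (f : (Fin n → ℝ) → ℂ) (x : Fin n → ℝ) : ℂ :=
  ∑ i, pd (fun y => pd f i y) i x

/-- The horizontal weak conformality quantity `Σ_{i=1}^n (∂f/∂x^i)²` on `ℝ^n`. -/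
noncomputable def hwcR {n : ℕ} (f : (Fin n → ℝ) → ℂ) (x : Fin n → ℝ) : ℂ :=
  ∑ i, (pd f i x) ^ 2

theorem aux_sum_split (k : ℕ) (f : Fin (2 * k + 5) → ℂ) :
    ∑ i, f i = f ⟨0, by omega⟩ + f ⟨1, by omega⟩ + f ⟨2, by omega⟩ + f ⟨3, by omega⟩
      + f ⟨4, by omega⟩
      + ∑ j : Fin k, (f ⟨5 + 2 * j, by omega⟩ + f ⟨6 + 2 * j, by omega⟩) := by
  induction k with
  | zero => simp [Fin.sum_univ_succ]; ring_nf
  | succ k ih =>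
    have h := ih (fun i => f ⟨i, by omega⟩)
    have e : ∑ i, f i = (∑ i : Fin (2 * k + 5), f ⟨i, by omega⟩) + f ⟨5 + 2 * k, by omega⟩
        + f ⟨6 + 2 * k, by omega⟩ := by
      have h1 := Fin.sum_univ_castSucc (n := 2 * k + 6) f
      have h2 := Fin.sum_univ_castSucc (n := 2 * k + 5) (fun i => f (Fin.castSucc i))
      refine h1.trans ?_
      rw [h2]
      congr 1
      · congr 1
        congr 1
        ext
        simp [Fin.last]; omega
      · congr 1
        ext
        simp [Fin.last]; omega
    rw [e, h, Fin.sum_univ_castSucc]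
    simp only [Fin.val_castSucc, Fin.val_last]
    ring

/-- Complex-valued real-linear coordinate. -/
noncomputable def cc {n : ℕ} (i : Fin n) : (Fin n → ℝ) →L[ℝ] ℂ :=
  Complex.ofRealCLM.comp (ContinuousLinearMap.proj i)

theorem cc_apply {n : ℕ} (i : Fin n) (x : Fin n → ℝ) : cc i x = (x i : ℂ) := rfl

/-- The holomorphic-type linear coordinate. -/
noncomputable def zz {n : ℕ} (i j : Fin n) : (Fin n → ℝ) →L[ℝ] ℂ := cc i + Complex.I • cc j

theorem zz_apply {n : ℕ} (i j : Fin n) (x : Fin n → ℝ) :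
    zz i j x = (x i : ℂ) + Complex.I * (x j : ℂ) := rfl

/-- The conjugate linear coordinate. -/
noncomputable def zb {n : ℕ} (i j : Fin n) : (Fin n → ℝ) →L[ℝ] ℂ := cc i - Complex.I • cc j

theorem zb_apply {n : ℕ} (i j : Fin n) (x : Fin n → ℝ) :
    zb i j x = (x i : ℂ) - Complex.I * (x j : ℂ) := rfl

section
variable (k : ℕ)

noncomputable def T : (Fin (2 * k + 5) → ℝ) →L[ℝ] ℂ := cc ⟨0, by omega⟩
noncomputable def Z : (Fin (2 * k + 5) → ℝ) →L[ℝ] ℂ := zz ⟨1, by omega⟩ ⟨2, by omega⟩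
noncomputable def Zb : (Fin (2 * k + 5) → ℝ) →L[ℝ] ℂ := zb ⟨1, by omega⟩ ⟨2, by omega⟩
noncomputable def W : (Fin (2 * k + 5) → ℝ) →L[ℝ] ℂ := zz ⟨3, by omega⟩ ⟨4, by omega⟩
noncomputable def V (j : Fin k) : (Fin (2 * k + 5) → ℝ) →L[ℝ] ℂ :=
  zz ⟨5 + 2 * j, by omega⟩ ⟨6 + 2 * j, by omega⟩

/-- The example map. -/
noncomputable def ps (x : Fin (2 * k + 5) → ℝ) : ℂ :=
  Z k x + 2 * W k x * T k x - (W k x) ^ 2 * Zb k x + ∑ j, (V k j x) ^ 2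

theorem ps_contDiff : ContDiff ℝ (⊤ : ℕ∞) (ps k) := by
  unfold ps
  fun_prop

theorem ps_fderiv (x v : Fin (2 * k + 5) → ℝ) :
    fderiv ℝ (ps k) x v = Z k v + 2 * W k v * T k x + 2 * W k x * T k v
      - 2 * W k x * W k v * Zb k x - (W k x) ^ 2 * Zb k v + ∑ j, 2 * V k j x * V k j v := by
  have hZ := (Z k).hasFDerivAt (x := x)
  have hW := (W k).hasFDerivAt (x := x)
  have hT := (T k).hasFDerivAt (x := x)
  have hZb := (Zb k).hasFDerivAt (x := x)
  have hV : ∀ j ∈ (Finset.univ : Finset (Fin k)), HasFDerivAt (fun y => (V k j y) ^ 2) _ x :=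
    fun j _ => ((V k j).hasFDerivAt (x := x)).pow 2
  have h := ((hZ.add ((hW.const_mul 2).mul hT)).sub ((hW.pow 2).mul hZb)).add
    (HasFDerivAt.fun_sum hV)
  have h' : HasFDerivAt (ps k) _ x := h
  rw [h'.fderiv]
  simp
  ring

theorem ps_eval (x v : Fin (2 * k + 5) → ℝ) :
    fderiv ℝ (ps k) x v = (v ⟨0, by omega⟩ : ℂ) * (2 * W k x)
      + (v ⟨1, by omega⟩ : ℂ) * (1 - (W k x) ^ 2)
      + (v ⟨2, by omega⟩ : ℂ) * (Complex.I * (1 + (W k x) ^ 2))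
      + ((v ⟨3, by omega⟩ : ℂ) + Complex.I * (v ⟨4, by omega⟩ : ℂ))
        * (2 * T k x - 2 * W k x * Zb k x)
      + ∑ j : Fin k, 2 * V k j x *
        ((v ⟨5 + 2 * j, by omega⟩ : ℂ) + Complex.I * (v ⟨6 + 2 * j, by omega⟩ : ℂ)) := by
  rw [ps_fderiv]
  have e : ∀ j : Fin k, V k j v =
    ((v ⟨5 + 2 * j, by omega⟩ : ℂ) + Complex.I * (v ⟨6 + 2 * j, by omega⟩ : ℂ)) := fun _ => rfl
  simp only [e]
  have e1 : W k v = (v ⟨3, by omega⟩ : ℂ) + Complex.I * (v ⟨4, by omega⟩ : ℂ) := rfl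
  have e2 : Z k v = (v ⟨1, by omega⟩ : ℂ) + Complex.I * (v ⟨2, by omega⟩ : ℂ) := rfl
  have e3 : Zb k v = (v ⟨1, by omega⟩ : ℂ) - Complex.I * (v ⟨2, by omega⟩ : ℂ) := rfl
  have e4 : T k v = (v ⟨0, by omega⟩ : ℂ) := rfl
  rw [e1, e2, e3, e4]
  ring

theorem pd0 : pd (ps k) ⟨0, by omega⟩ = fun x => 2 * W k x := by
  funext x
  unfold pd
  rw [ps_eval]
  simp [-Fin.mk_one, -Fin.zero_eta, Pi.single_apply]

theorem pd1 : pd (ps k) ⟨1, by omega⟩ = fun x => 1 - (W k x) ^ 2 := by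
  funext x
  unfold pd
  rw [ps_eval]
  simp [-Fin.mk_one, -Fin.zero_eta, Pi.single_apply]
  refine Finset.sum_eq_zero fun j _ => ?_
  rw [if_neg (by omega), if_neg (by omega)]; simp

theorem pd2 : pd (ps k) ⟨2, by omega⟩ = fun x => Complex.I * (1 + (W k x) ^ 2) := by
  funext x
  unfold pd
  rw [ps_eval]
  simp [-Fin.mk_one, -Fin.zero_eta, Pi.single_apply]
  refine Finset.sum_eq_zero fun j _ => ?_
  rw [if_neg (by omega), if_neg (by omega)]; simp

theorem pd3 : pd (ps k) ⟨3, by omega⟩ = fun x => 2 * T k x - 2 * W k x * Zb k x := by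
  funext x
  unfold pd
  rw [ps_eval]
  simp [-Fin.mk_one, -Fin.zero_eta, Pi.single_apply]
  refine Finset.sum_eq_zero fun j _ => ?_
  rw [if_neg (by omega), if_neg (by omega)]; simp

theorem pd4 : pd (ps k) ⟨4, by omega⟩ =
    fun x => Complex.I * (2 * T k x - 2 * W k x * Zb k x) := by
  funext x
  unfold pd
  rw [ps_eval]
  simp [-Fin.mk_one, -Fin.zero_eta, Pi.single_apply]
  refine Finset.sum_eq_zero fun j _ => ?_
  rw [if_neg (by omega), if_neg (by omega)]; simp

theorem pd5 (j : Fin k) : pd (ps k) ⟨5 + 2 * j, by omega⟩ = fun x => 2 * V k j x := by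
  funext x
  unfold pd
  rw [ps_eval]
  rw [Finset.sum_eq_single j]
  · have h0 : ¬ (0 = 5 + 2 * (j : ℕ)) := by omega
    have h1 : ¬ (1 = 5 + 2 * (j : ℕ)) := by omega
    have h2 : ¬ (2 = 5 + 2 * (j : ℕ)) := by omega
    have h3 : ¬ (3 = 5 + 2 * (j : ℕ)) := by omega
    have h4 : ¬ (4 = 5 + 2 * (j : ℕ)) := by omega
    have h6 : ¬ (6 + 2 * (j : ℕ) = 5 + 2 * (j : ℕ)) := by omega
    simp [-Fin.mk_one, -Fin.zero_eta, Pi.single_apply, h0, h1, h2, h3, h4, h6]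
  · intro l _ hl
    have hl' : ¬ ((l : ℕ) = j) := fun h => hl (Fin.ext h)
    have h5 : ¬ (5 + 2 * (l : ℕ) = 5 + 2 * (j : ℕ)) := by omega
    have h6 : ¬ (6 + 2 * (l : ℕ) = 5 + 2 * (j : ℕ)) := by omega
    simp only [Pi.single_apply, Fin.mk.injEq, h5, h6, if_false]
    simp
  · simp

theorem pd6 (j : Fin k) : pd (ps k) ⟨6 + 2 * j, by omega⟩ =
    fun x => Complex.I * (2 * V k j x) := by
  funext x
  unfold pd
  rw [ps_eval]
  rw [Finset.sum_eq_single j]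
  · have h0 : ¬ (0 = 6 + 2 * (j : ℕ)) := by omega
    have h1 : ¬ (1 = 6 + 2 * (j : ℕ)) := by omega
    have h2 : ¬ (2 = 6 + 2 * (j : ℕ)) := by omega
    have h3 : ¬ (3 = 6 + 2 * (j : ℕ)) := by omega
    have h4 : ¬ (4 = 6 + 2 * (j : ℕ)) := by omega
    have h6 : ¬ (5 + 2 * (j : ℕ) = 6 + 2 * (j : ℕ)) := by omega
    simp [-Fin.mk_one, -Fin.zero_eta, Pi.single_apply, h0, h1, h2, h3, h4, h6]
    ring
  · intro l _ hl
    have hl' : ¬ ((l : ℕ) = j) := fun h => hl (Fin.ext h)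
    have h5 : ¬ (5 + 2 * (l : ℕ) = 6 + 2 * (j : ℕ)) := by omega
    have h6 : ¬ (6 + 2 * (l : ℕ) = 6 + 2 * (j : ℕ)) := by omega
    simp only [Pi.single_apply, Fin.mk.injEq, h5, h6, if_false]
    simp
  · simp

theorem ps_hwc (x : Fin (2 * k + 5) → ℝ) : hwcR (ps k) x = 0 := by
  unfold hwcR
  rw [aux_sum_split, pd0, pd1, pd2, pd3, pd4]
  simp only [pd5, pd6, mul_pow, Complex.I_sq]
  simp only [neg_mul, one_mul, add_neg_cancel, Finset.sum_const_zero]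
  ring

/-- Derivative of a function of one linear coordinate that kills the direction. -/
theorem pd_lin {n : ℕ} (c : ℂ) (L : (Fin n → ℝ) →L[ℝ] ℂ) (i : Fin n) (x : Fin n → ℝ) :
    pd (fun y => c * L y) i x = c * L (Pi.single i 1) := by
  unfold pd
  rw [((L.hasFDerivAt (x := x)).const_mul c).fderiv]
  simp

theorem pd_quad {n : ℕ} (a b c : ℂ) (L : (Fin n → ℝ) →L[ℝ] ℂ) (i : Fin n) (x : Fin n → ℝ) :
    pd (fun y => a * (b + c * (L y) ^ 2)) i x = a * (c * (2 * L x * L (Pi.single i 1))) := by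
  unfold pd
  rw [((((L.hasFDerivAt (x := x)).pow 2).const_mul c).const_add b |>.const_mul a).fderiv]
  simp

theorem pd_mix {n : ℕ} (a : ℂ) (L M N : (Fin n → ℝ) →L[ℝ] ℂ) (i : Fin n) (x : Fin n → ℝ) :
    pd (fun y => a * (2 * L y - 2 * M y * N y)) i x
      = a * (2 * L (Pi.single i 1) - 2 * M (Pi.single i 1) * N x
        - 2 * M x * N (Pi.single i 1)) := by
  unfold pd
  have hL := L.hasFDerivAt (x := x)
  have hM := M.hasFDerivAt (x := x)
  have hN := N.hasFDerivAt (x := x)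
  have h := ((hL.const_mul 2).sub ((hM.const_mul 2).mul hN)).const_mul a
  have h' : HasFDerivAt (fun y => a * (2 * L y - 2 * M y * N y)) _ x := h
  rw [h'.fderiv]
  simp
  left
  ring

theorem ps_lap (x : Fin (2 * k + 5) → ℝ) : lapR (ps k) x = 0 := by
  unfold lapR
  rw [aux_sum_split]
  have h0 : pd (fun y => pd (ps k) ⟨0, by omega⟩ y) ⟨0, by omega⟩ x = 0 := by
    rw [pd0, pd_lin]; simp [-Fin.mk_one, -Fin.zero_eta, W, zz_apply, Pi.single_apply]
  have h1 : pd (fun y => pd (ps k) ⟨1, by omega⟩ y) ⟨1, by omega⟩ x = 0 := by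
    have e : (fun y => pd (ps k) ⟨1, by omega⟩ y) = fun y => 1 * (1 + (-1) * (W k y) ^ 2) := by
      rw [pd1]; funext y; ring
    rw [e, pd_quad]; simp [-Fin.mk_one, -Fin.zero_eta, W, zz_apply, Pi.single_apply]
  have h2 : pd (fun y => pd (ps k) ⟨2, by omega⟩ y) ⟨2, by omega⟩ x = 0 := by
    have e : (fun y => pd (ps k) ⟨2, by omega⟩ y)
        = fun y => Complex.I * (1 + 1 * (W k y) ^ 2) := by
      rw [pd2]; funext y; ring
    rw [e, pd_quad]; simp [-Fin.mk_one, -Fin.zero_eta, W, zz_apply, Pi.single_apply]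
  have h3 : pd (fun y => pd (ps k) ⟨3, by omega⟩ y) ⟨3, by omega⟩ x = - 2 * Zb k x := by
    have e : (fun y => pd (ps k) ⟨3, by omega⟩ y)
        = fun y => 1 * (2 * T k y - 2 * W k y * Zb k y) := by
      rw [pd3]; funext y; ring
    rw [e, pd_mix]; simp [-Fin.mk_one, -Fin.zero_eta, W, T, Zb, zz_apply, zb_apply, cc_apply, Pi.single_apply]
  have h4 : pd (fun y => pd (ps k) ⟨4, by omega⟩ y) ⟨4, by omega⟩ x = 2 * Zb k x := by
    rw [pd4, pd_mix]; simp [-Fin.mk_one, -Fin.zero_eta, W, T, Zb, zz_apply, zb_apply, cc_apply, Pi.single_apply]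
    linear_combination (-2 * ((x ⟨1, by omega⟩ : ℂ) - Complex.I * x ⟨2, by omega⟩)) * Complex.I_sq
  rw [h0, h1, h2, h3, h4]
  have h5 : ∀ j : Fin k, pd (fun y => pd (ps k) ⟨5 + 2 * j, by omega⟩ y) ⟨5 + 2 * j, by omega⟩ x
      + pd (fun y => pd (ps k) ⟨6 + 2 * j, by omega⟩ y) ⟨6 + 2 * j, by omega⟩ x = 0 := by
    intro j
    have e : (fun y => pd (ps k) ⟨6 + 2 * j, by omega⟩ y)
        = fun y => (Complex.I * 2) * V k j y := by
      rw [pd6]; funext y; ring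
    rw [pd5, e, pd_lin, pd_lin]
    simp [V, zz_apply, Pi.single_apply]
    linear_combination 2 * Complex.I_sq
  rw [Finset.sum_eq_zero fun j _ => h5 j]
  ring

theorem surj_aux (p q r y : ℂ) (h : p ^ 2 + q ^ 2 + r ^ 2 = 0) (hN : ¬ (p = 0 ∧ q = 0 ∧ r = 0)) :
    ∃ a b c : ℝ, (a : ℂ) * p + b * q + c * r = y := by
  set N : ℝ := Complex.normSq p + Complex.normSq q + Complex.normSq r with hNdef
  have hN0 : N ≠ 0 := by
    intro h0
    have hp := Complex.normSq_nonneg p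
    have hq := Complex.normSq_nonneg q
    have hr := Complex.normSq_nonneg r
    exact hN ⟨Complex.normSq_eq_zero.1 (by linarith), Complex.normSq_eq_zero.1 (by linarith),
      Complex.normSq_eq_zero.1 (by linarith)⟩
  have hre := congrArg Complex.re h
  have him := congrArg Complex.im h
  simp [pow_two] at hre him
  simp only [Complex.normSq_apply] at hNdef
  refine ⟨2 * (p.re * y.re + p.im * y.im) / N, 2 * (q.re * y.re + q.im * y.im) / N,
    2 * (r.re * y.re + r.im * y.im) / N, ?_⟩
  apply Complex.ext
  · simp
    field_simp
    rw [hNdef]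
    linear_combination y.re * hre + y.im * him
  · simp
    field_simp
    rw [hNdef]
    linear_combination y.re * him - y.im * hre

theorem ps_surj (x : Fin (2 * k + 5) → ℝ) : Function.Surjective (fderiv ℝ (ps k) x) := by
  intro y
  obtain ⟨a, b, c, h⟩ := surj_aux (2 * W k x) (1 - (W k x) ^ 2) (Complex.I * (1 + (W k x) ^ 2)) y
    (by rw [mul_pow Complex.I, Complex.I_sq]; ring)
    (by
      rintro ⟨h1, h2, _⟩
      have : W k x = 0 := by simpa using h1
      rw [this] at h2
      simp at h2)
  refine ⟨a • Pi.single ⟨0, by omega⟩ 1 + b • Pi.single ⟨1, by omega⟩ 1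
    + c • Pi.single ⟨2, by omega⟩ 1, ?_⟩
  rw [map_add, map_add, map_smul, map_smul, map_smul]
  have e0 := congrFun (pd0 k) x
  have e1 := congrFun (pd1 k) x
  have e2 := congrFun (pd2 k) x
  unfold pd at e0 e1 e2
  rw [e0, e1, e2, ← h]
  simp

theorem two_real {a b : ℝ} (h : (a : ℂ) + Complex.I * b = 0) : a = 0 ∧ b = 0 := by
  have h1 := congrArg Complex.re h
  have h2 := congrArg Complex.im h
  simp at h1 h2
  exact ⟨h1, h2⟩

theorem ps_full (v : Fin (2 * k + 5) → ℝ) (hv : v ≠ 0) : ∃ x, fderiv ℝ (ps k) x v ≠ 0 := by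
  by_contra! H
  apply hv
  simp only [ps_eval] at H
  have A0 := H 0
  simp [-Fin.mk_one, -Fin.zero_eta] at A0
  have A : v ⟨1, by omega⟩ = 0 ∧ v ⟨2, by omega⟩ = 0 :=
    two_real (by linear_combination A0)
  have B0 := H (Pi.single ⟨0, by omega⟩ 1)
  have hV0 : ∀ i : Fin (2 * k + 5), (i : ℕ) < 5 → ∀ j, V k j (Pi.single i 1) = 0 := by
    intro i hi j
    have h5 : ¬ (5 + 2 * (j : ℕ) = i) := by omega
    have h6 : ¬ (6 + 2 * (j : ℕ) = i) := by omega
    simp only [V, zz_apply, Pi.single_apply, Fin.ext_iff, h5, h6, if_false]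
    simp
  simp only [hV0 ⟨0, by omega⟩ (by simp)] at B0
  simp [-Fin.mk_one, -Fin.zero_eta, A.1, A.2, T, W, Zb, cc_apply, zz_apply, zb_apply, Pi.single_apply] at B0
  have B : v ⟨3, by omega⟩ = 0 ∧ v ⟨4, by omega⟩ = 0 := two_real B0
  have C0 := H (Pi.single ⟨3, by omega⟩ 1)
  simp only [hV0 ⟨3, by omega⟩ (by simp)] at C0
  simp [-Fin.mk_one, -Fin.zero_eta, A.1, A.2, B.1, B.2, T, W, Zb, cc_apply, zz_apply, zb_apply, Pi.single_apply] at C0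
  have D : ∀ j : Fin k, v ⟨5 + 2 * j, by omega⟩ = 0 ∧ v ⟨6 + 2 * j, by omega⟩ = 0 := by
    intro j
    have D0 := H (Pi.single ⟨5 + 2 * j, by omega⟩ 1)
    rw [Finset.sum_eq_single j] at D0
    · have e : V k j (Pi.single ⟨5 + 2 * j, by omega⟩ 1) = 1 := by
        simp [V, zz_apply, Pi.single_apply]
      have ew : W k (Pi.single ⟨5 + 2 * j, by omega⟩ 1) = 0 := by
        have h3 : ¬ (3 = 5 + 2 * (j : ℕ)) := by omega
        have h4 : ¬ (4 = 5 + 2 * (j : ℕ)) := by omega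
        simp [-Fin.mk_one, -Fin.zero_eta, W, zz_apply, Pi.single_apply, h3, h4]
      rw [e, ew, A.1, A.2, B.1, B.2] at D0
      simp at D0
      exact two_real D0
    · intro l _ hl
      have hl' : ¬ ((l : ℕ) = j) := fun h => hl (Fin.ext h)
      have h5 : ¬ (5 + 2 * (l : ℕ) = 5 + 2 * (j : ℕ)) := by omega
      have h6 : ¬ (6 + 2 * (l : ℕ) = 5 + 2 * (j : ℕ)) := by omega
      have e : V k l (Pi.single ⟨5 + 2 * j, by omega⟩ 1) = 0 := by
        simp only [V, zz_apply, Pi.single_apply, Fin.mk.injEq, h5, h6, if_false]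
        simp
      rw [e]; simp
    · simp
  funext ⟨i, hi⟩
  rcases Nat.lt_or_ge i 5 with h | h
  · interval_cases i
    · exact C0
    · exact A.1
    · exact A.2
    · exact B.1
    · exact B.2
  · obtain ⟨q, hq⟩ : ∃ q, i = 5 + 2 * q ∨ i = 6 + 2 * q := ⟨(i - 5) / 2, by omega⟩
    rcases hq with rfl | rfl
    · exact (D ⟨q, by omega⟩).1
    · exact (D ⟨q, by omega⟩).2

end

theorem ps_exists (n k : ℕ) (h : n = 2 * k + 5) :
    ∃ ψ : (Fin n → ℝ) → ℂ, ContDiff ℝ (⊤ : ℕ∞) ψ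
      ∧ (∀ x, lapR ψ x = 0)
      ∧ (∀ x, hwcR ψ x = 0)
      ∧ (∀ x, Function.Surjective (fderiv ℝ ψ x))
      ∧ (∀ v : Fin n → ℝ, v ≠ 0 → ∃ x, fderiv ℝ ψ x v ≠ 0) := by
  subst h
  exact ⟨ps k, ps_contDiff k, ps_lap k, ps_hwc k, ps_surj k, ps_full k⟩

/-- global examples in odd dimensions: for every `m ≥ 3` there is
a smooth, globally defined `ψ : ℝ^{2m−1} → ℂ` which is harmonic, horizontally
weakly conformal (hence a harmonic morphism), submersive, full, and whose
trivial extension `Φ(x¹,…,x^{2m}) = ψ(x²,…,x^{2m})` to `ℝ^{2m}` is not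
holomorphic with respect to any Kähler structure (constant orthogonal complex
structure `J`, orthogonality expressed by preservation of the Euclidean inner
product); hence `ψ` does not arise from a Kähler structure. -/
theorem global_odd_example {m : ℕ} (hm : 3 ≤ m) :
    ∃ ψ : (Fin (2 * m - 1) → ℝ) → ℂ, ContDiff ℝ (⊤ : ℕ∞) ψ
      ∧ (∀ x, lapR ψ x = 0)
      ∧ (∀ x, hwcR ψ x = 0)
      ∧ (∀ x, Function.Surjective (fderiv ℝ ψ x))
      ∧ (∀ v : Fin (2 * m - 1) → ℝ, v ≠ 0 → ∃ x, fderiv ℝ ψ x v ≠ 0)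
      ∧ ¬ (∃ J : (Fin (2 * m) → ℝ) →ₗ[ℝ] (Fin (2 * m) → ℝ),
            (∀ v w : Fin (2 * m) → ℝ, ∑ i, J v i * J w i = ∑ i, v i * w i)
            ∧ (∀ v, J (J v) = -v)
            ∧ (∀ x v, fderiv ℝ
                (fun y : Fin (2 * m) → ℝ =>
                  ψ (fun i : Fin (2 * m - 1) => y ⟨(i : ℕ) + 1, by have := i.isLt; omega⟩))
                x (J v)
              = Complex.I * fderiv ℝ
                (fun y : Fin (2 * m) → ℝ =>
                  ψ (fun i : Fin (2 * m - 1) => y ⟨(i : ℕ) + 1, by have := i.isLt; omega⟩))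
                x v)) := by
  obtain ⟨ψ, h1, h2, h3, h4, h5⟩ := ps_exists (2 * m - 1) (m - 3) (by omega)
  refine ⟨ψ, h1, h2, h3, h4, h5, ?_⟩
  rintro ⟨J, hJ, hJJ, hol⟩
  let P : (Fin (2 * m) → ℝ) →L[ℝ] (Fin (2 * m - 1) → ℝ) :=
    ContinuousLinearMap.pi fun i : Fin (2 * m - 1) =>
      ContinuousLinearMap.proj (⟨(i : ℕ) + 1, by have := i.isLt; omega⟩ : Fin (2 * m))
  have hd : ∀ x v, fderiv ℝ (fun y : Fin (2 * m) → ℝ =>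
      ψ (fun i : Fin (2 * m - 1) => y ⟨(i : ℕ) + 1, by have := i.isLt; omega⟩)) x v
      = fderiv ℝ ψ (P x) (P v) := by
    intro x v
    have hψ : HasFDerivAt ψ (fderiv ℝ ψ (P x)) (P x) :=
      ((h1.differentiable (by simp)) (P x)).hasFDerivAt
    have hc : HasFDerivAt (fun y : Fin (2 * m) → ℝ =>
      ψ (fun i : Fin (2 * m - 1) => y ⟨(i : ℕ) + 1, by have := i.isLt; omega⟩))
        ((fderiv ℝ ψ (P x)).comp P) x := hψ.comp x (P.hasFDerivAt (x := x))
    rw [hc.fderiv]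
    rfl
  set z : Fin (2 * m) := ⟨0, by omega⟩ with hz
  set e : Fin (2 * m) → ℝ := Pi.single z 1 with he
  have hPe : P e = 0 := by
    funext i
    simp [P, he, hz, Pi.single_apply]
  have hJe : P (J e) = 0 := by
    by_contra hne
    obtain ⟨x, hx⟩ := h5 _ hne
    apply hx
    have hP : P (fun i => if h : (i : ℕ) = 0 then 0 else x ⟨(i : ℕ) - 1, by omega⟩) = x := by
      funext i
      simp [P]
    have := hol (fun i => if h : (i : ℕ) = 0 then 0 else x ⟨(i : ℕ) - 1, by omega⟩) e
    rw [hd, hd, hPe, hP] at this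
    simpa using this
  have hz0 : J e z = 0 := by
    have h := hJ e (J e)
    rw [hJJ] at h
    simp [he, Pi.single_apply] at h
    rw [← he] at h
    linarith
  have hJe0 : J e = 0 := by
    funext ⟨i, hi⟩
    rcases Nat.eq_zero_or_pos i with h | h
    · subst h; exact hz0
    · have := congrFun hJe ⟨i - 1, by omega⟩
      have e1 : (⟨i, hi⟩ : Fin (2 * m)) = ⟨i - 1 + 1, by omega⟩ := by
        ext; simp; omega
      rw [e1]
      exact this
  have := hJJ e
  rw [hJe0, map_zero] at this
  have := congrFun this z
  simp [he] at this
end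

section
/- (Implicit quadratic harmonic morphism on ℝ⁶.) Define Q : ℂ³ × ℂ → ℂ by Q(q, z) = z² q̄¹(q̄² + q̄³) + z·(q̄¹ + q²(q̄² + q̄³) − q¹q̄¹) + q³ − q¹q². Let U ⊆ ℂ³ be open and let z¹ : U → ℂ be a smooth map with Q(q, z¹(q)) = 0 and (∂Q/∂z)(q, z¹(q)) ≠ 0 for every q ∈ U, where ∂Q/∂z = 2z q̄¹(q̄² + q̄³) + q̄¹ + q²(q̄² + q̄³) − q¹q̄¹. Then Δz¹ = 0 and Σ_{i=1}^{6} (∂z¹/∂x^i)² = 0 on U; i.e. z¹ is a harmonic morphism. -/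
open Complex BigOperators Matrix

/-- The quadratic `Q(q,z) = z²q̄¹(q̄² + q̄³) + z(q̄¹ + q²(q̄² + q̄³) − q¹q̄¹) + q³ − q¹q²`
(0-based indices). -/
noncomputable def Qquad (q : Fin 3 → ℂ) (z : ℂ) : ℂ :=
  z ^ 2 * starRingEnd ℂ (q 0) * (starRingEnd ℂ (q 1) + starRingEnd ℂ (q 2)) +
    z * (starRingEnd ℂ (q 0) + q 1 * (starRingEnd ℂ (q 1) + starRingEnd ℂ (q 2))
      - q 0 * starRingEnd ℂ (q 0)) +
    q 2 - q 0 * q 1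

theorem line_id {q v : Fin 3 → ℂ} (i : Fin 3) :
    HasDerivAt (fun t : ℝ => (q + t • v) i) (v i) 0 := by
  have h : HasDerivAt (fun t : ℝ => q i + t • v i) ((1 : ℝ) • v i) 0 :=
    ((hasDerivAt_id (0 : ℝ)).smul_const (v i)).const_add (q i)
  simpa using h

theorem line_conj {q v : Fin 3 → ℂ} (i : Fin 3) :
    HasDerivAt (fun t : ℝ => starRingEnd ℂ ((q + t • v) i)) (starRingEnd ℂ (v i)) 0 :=
  (line_id i).star

theorem line_fun {f : (Fin 3 → ℂ) → ℂ} {q v : Fin 3 → ℂ} (hf : DifferentiableAt ℝ f q) :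
    HasDerivAt (fun t : ℝ => f (q + t • v)) (fderiv ℝ f q v) 0 :=
  hf.hasFDerivAt.hasLineDerivAt v

theorem line_mem {U : Set (Fin 3 → ℂ)} (hU : IsOpen U) {q : Fin 3 → ℂ} (hq : q ∈ U)
    (v : Fin 3 → ℂ) : ∀ᶠ t : ℝ in nhds 0, q + t • v ∈ U := by
  have hc : Continuous (fun t : ℝ => q + t • v) := by fun_prop
  exact hc.continuousAt.eventually_mem (hU.mem_nhds (by simpa using hq))

/-- If a function vanishes on an open set, its derivative along lines vanishes. -/
theorem line_zero {U : Set (Fin 3 → ℂ)} (hU : IsOpen U) {q : Fin 3 → ℂ} (hq : q ∈ U)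
    (v : Fin 3 → ℂ) {F : (Fin 3 → ℂ) → ℂ} (hF : ∀ y ∈ U, F y = 0) {d : ℂ}
    (hd : HasDerivAt (fun t : ℝ => F (q + t • v)) d 0) : d = 0 := by
  have h0 : HasDerivAt (fun t : ℝ => F (q + t • v)) 0 0 := by
    refine (hasDerivAt_const (0 : ℝ) (0 : ℂ)).congr_of_eventuallyEq ?_
    filter_upwards [line_mem hU hq v] with t ht using hF _ ht
  exact hd.unique h0

theorem first_eq {U : Set (Fin 3 → ℂ)} (hU : IsOpen U) {z : (Fin 3 → ℂ) → ℂ}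
    (hz : ∀ y ∈ U, DifferentiableAt ℝ z y) (hsol : ∀ q ∈ U, Qquad q (z q) = 0)
    (v : Fin 3 → ℂ) : ∀ q ∈ U,
    fderiv ℝ z q v * (2 * z q * starRingEnd ℂ (q 0) * (starRingEnd ℂ (q 1) + starRingEnd ℂ (q 2))
        + starRingEnd ℂ (q 0) + q 1 * (starRingEnd ℂ (q 1) + starRingEnd ℂ (q 2)) - q 0 * starRingEnd ℂ (q 0))
      + z q ^ 2 * (starRingEnd ℂ (v 0) * (starRingEnd ℂ (q 1) + starRingEnd ℂ (q 2)) + starRingEnd ℂ (q 0) * (starRingEnd ℂ (v 1) + starRingEnd ℂ (v 2)))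
      + z q * (starRingEnd ℂ (v 0) + v 1 * (starRingEnd ℂ (q 1) + starRingEnd ℂ (q 2)) + q 1 * (starRingEnd ℂ (v 1) + starRingEnd ℂ (v 2))
        - v 0 * starRingEnd ℂ (q 0) - q 0 * starRingEnd ℂ (v 0))
      + v 2 - v 0 * q 1 - q 0 * v 1 = 0 := by
  intro q hq
  have a := line_id (q := q) (v := v) 0
  have b := line_id (q := q) (v := v) 1
  have c := line_id (q := q) (v := v) 2
  have A := line_conj (q := q) (v := v) 0
  have S := (line_conj (q := q) (v := v) 1).add (line_conj (q := q) (v := v) 2)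
  have Z := line_fun (v := v) (hz q hq)
  have H := (((((Z.pow 2).mul A).mul S).add (Z.mul ((A.add (b.mul S)).sub (a.mul A)))).add c).sub
    (a.mul b)
  have := line_zero hU hq v (F := fun y => Qquad y (z y)) hsol H
  simp at this
  linear_combination this

theorem second_eq {U : Set (Fin 3 → ℂ)} (hU : IsOpen U) {z : (Fin 3 → ℂ) → ℂ}
    (hz : ∀ y ∈ U, DifferentiableAt ℝ z y) (hsol : ∀ q ∈ U, Qquad q (z q) = 0)
    (v : Fin 3 → ℂ) (hp : ∀ y ∈ U, DifferentiableAt ℝ (fun y => fderiv ℝ z y v) y) : ∀ q ∈ U,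
    fderiv ℝ (fun y => fderiv ℝ z y v) q v * (2 * z q * starRingEnd ℂ (q 0) * (starRingEnd ℂ (q 1) + starRingEnd ℂ (q 2))
        + starRingEnd ℂ (q 0) + q 1 * (starRingEnd ℂ (q 1) + starRingEnd ℂ (q 2)) - q 0 * starRingEnd ℂ (q 0))
      + 2 * (fderiv ℝ z q v) ^ 2 * starRingEnd ℂ (q 0) * (starRingEnd ℂ (q 1) + starRingEnd ℂ (q 2))
      + 2 * fderiv ℝ z q v *
        (2 * z q * (starRingEnd ℂ (v 0) * (starRingEnd ℂ (q 1) + starRingEnd ℂ (q 2)) + starRingEnd ℂ (q 0) * (starRingEnd ℂ (v 1) + starRingEnd ℂ (v 2)))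
        + starRingEnd ℂ (v 0) + v 1 * (starRingEnd ℂ (q 1) + starRingEnd ℂ (q 2)) + q 1 * (starRingEnd ℂ (v 1) + starRingEnd ℂ (v 2))
        - v 0 * starRingEnd ℂ (q 0) - q 0 * starRingEnd ℂ (v 0))
      + 2 * z q ^ 2 * starRingEnd ℂ (v 0) * (starRingEnd ℂ (v 1) + starRingEnd ℂ (v 2))
      + 2 * z q * (v 1 * (starRingEnd ℂ (v 1) + starRingEnd ℂ (v 2)) - v 0 * starRingEnd ℂ (v 0))
      - 2 * v 0 * v 1 = 0 := by
  intro q hq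
  have a := line_id (q := q) (v := v) 0
  have b := line_id (q := q) (v := v) 1
  have A := line_conj (q := q) (v := v) 0
  have S := (line_conj (q := q) (v := v) 1).add (line_conj (q := q) (v := v) 2)
  have Z := line_fun (v := v) (hz q hq)
  have P := line_fun (v := v) (hp q hq)
  have H := ((((((P.mul ((((((Z.const_mul 2).mul A).mul S).add A).add (b.mul S)).sub (a.mul A))).add
    ((Z.pow 2).mul ((S.const_mul (starRingEnd ℂ (v 0))).add (A.mul_const (starRingEnd ℂ (v 1) + starRingEnd ℂ (v 2)))))).add
    (Z.mul (((((S.const_mul (v 1)).const_add (starRingEnd ℂ (v 0))).add (b.mul_const (starRingEnd ℂ (v 1) + starRingEnd ℂ (v 2)))).sub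
      (A.const_mul (v 0))).sub (a.mul_const (starRingEnd ℂ (v 0)))))).add_const (v 2)).sub
    (b.const_mul (v 0))).sub (a.mul_const (v 1)))
  have := line_zero hU hq v (F := _) (first_eq hU hz hsol v) H
  simp at this
  linear_combination this

/-- implicit quadratic harmonic morphism on `ℝ⁶`: any smooth local
solution `z¹` of `Q(q, z¹(q)) = 0` with `(∂Q/∂z)(q, z¹(q)) ≠ 0` on an open set
`U ⊆ ℂ³` satisfies `Δz¹ = 0` and `Σ_{i=1}^6 (∂z¹/∂x^i)² = 0` on `U`, i.e. it is
a harmonic morphism. -/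
theorem implicit_quadratic_harmonic_morphism
    (U : Set (Fin 3 → ℂ)) (hU : IsOpen U)
    (z1 : (Fin 3 → ℂ) → ℂ) (hz1 : ContDiffOn ℝ (⊤ : ℕ∞) z1 U)
    (hsol : ∀ q ∈ U, Qquad q (z1 q) = 0)
    (hQz : ∀ q ∈ U,
      2 * z1 q * starRingEnd ℂ (q 0) * (starRingEnd ℂ (q 1) + starRingEnd ℂ (q 2))
        + starRingEnd ℂ (q 0) + q 1 * (starRingEnd ℂ (q 1) + starRingEnd ℂ (q 2))
        - q 0 * starRingEnd ℂ (q 0) ≠ 0) :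
    ∀ q ∈ U, lap z1 q = 0 ∧ hwc z1 q = 0 := by
  intro q hq
  have hz : ∀ y ∈ U, DifferentiableAt ℝ z1 y := fun y hy =>
    (hz1.contDiffAt (hU.mem_nhds hy)).differentiableAt (by simp)
  have hp : ∀ v : Fin 3 → ℂ, ∀ y ∈ U, DifferentiableAt ℝ (fun y => fderiv ℝ z1 y v) y := by
    intro v y hy
    have h1 : ContDiffAt ℝ 1 (fderiv ℝ z1) y :=
      (hz1.contDiffAt (hU.mem_nhds hy)).fderiv_right (m := 1) (by norm_cast)
    exact (h1.differentiableAt (by simp)).clm_apply (differentiableAt_const v)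
  have E1 := fun v => first_eq hU hz hsol v q hq
  have E2 := fun v => second_eq hU hz hsol v (hp v) q hq
  have hD := hQz q hq
  have r0 := E1 (Pi.single 0 1)
  have r1 := E1 (Pi.single 1 1)
  have r2 := E1 (Pi.single 2 1)
  have i0 := E1 (Pi.single 0 I)
  have i1 := E1 (Pi.single 1 I)
  have i2 := E1 (Pi.single 2 I)
  have R0 := E2 (Pi.single 0 1)
  have R1 := E2 (Pi.single 1 1)
  have R2 := E2 (Pi.single 2 1)
  have I0 := E2 (Pi.single 0 I)
  have I1 := E2 (Pi.single 1 I)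
  have I2 := E2 (Pi.single 2 I)
  clear E1 E2
  simp only [lap, hwc, pdRe, pdIm, Fin.sum_univ_three]
  generalize fderiv ℝ (fun y => fderiv ℝ z1 y (Pi.single 0 1)) q (Pi.single 0 1) = S0 at *
  generalize fderiv ℝ (fun y => fderiv ℝ z1 y (Pi.single 1 1)) q (Pi.single 1 1) = S1 at *
  generalize fderiv ℝ (fun y => fderiv ℝ z1 y (Pi.single 2 1)) q (Pi.single 2 1) = S2 at *
  generalize fderiv ℝ (fun y => fderiv ℝ z1 y (Pi.single 0 I)) q (Pi.single 0 I) = T0 at *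
  generalize fderiv ℝ (fun y => fderiv ℝ z1 y (Pi.single 1 I)) q (Pi.single 1 I) = T1 at *
  generalize fderiv ℝ (fun y => fderiv ℝ z1 y (Pi.single 2 I)) q (Pi.single 2 I) = T2 at *
  generalize fderiv ℝ z1 q (Pi.single 0 1) = p0 at *
  generalize fderiv ℝ z1 q (Pi.single 1 1) = p1 at *
  generalize fderiv ℝ z1 q (Pi.single 2 1) = p2 at *
  generalize fderiv ℝ z1 q (Pi.single 0 I) = m0 at *
  generalize fderiv ℝ z1 q (Pi.single 1 I) = m1 at *
  generalize fderiv ℝ z1 q (Pi.single 2 I) = m2 at *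
  clear hz hp hsol hQz hz1
  generalize z1 q = z at *
  generalize hA : starRingEnd ℂ (q 0) = A at *
  generalize hB : starRingEnd ℂ (q 1) = B at *
  generalize hC : starRingEnd ℂ (q 2) = C at *
  generalize q 0 = a at *
  generalize q 1 = b at *
  simp at r0 r1 r2 i0 i1 i2 R0 R1 R2 I0 I1 I2
  generalize hDD : 2 * z * A * (B + C) + A + b * (B + C) - a * A = D at *
  have hI : I ^ 2 + 1 = 0 := by simp
  have hH : p0 ^ 2 + m0 ^ 2 + (p1 ^ 2 + m1 ^ 2) + (p2 ^ 2 + m2 ^ 2) = 0 := by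
    apply (mul_eq_zero.mp _).resolve_right (pow_ne_zero 2 hD)
    clear hDD
    linear_combination
      (p0 * D - (z ^ 2 * (B + C) + z * (1 - A - a) - b)) * r0
      + (p1 * D - (z ^ 2 * A + z * (B + C + b) - a)) * r1
      + (p2 * D - (z ^ 2 * A + z * b + 1)) * r2
      + (m0 * D + I * (z ^ 2 * (B + C) + z * (1 + A - a) + b)) * i0
      + (m1 * D + I * (z ^ 2 * A - z * (B + C) + z * b + a)) * i1
      + (m2 * D + I * (z ^ 2 * A + z * b - 1)) * i2
      + ((z ^ 2 * (B + C) + z * (1 + A - a) + b) ^ 2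
        + (z ^ 2 * A - z * (B + C) + z * b + a) ^ 2 + (z ^ 2 * A + z * b - 1) ^ 2) * hI
  have hK : p0 * (2 * z * (B + C) + 1 - A - a) + p1 * (2 * z * A + (B + C) + b)
      + p2 * (2 * z * A + b) - m0 * I * (2 * z * (B + C) + 1 + A - a)
      - m1 * I * (2 * z * A - (B + C) + b) - m2 * I * (2 * z * A + b) = 0 := by
    apply (mul_eq_zero.mp _).resolve_right hD
    clear hDD
    linear_combination
      (2 * z * (B + C) + 1 - A - a) * r0 + (2 * z * A + (B + C) + b) * r1
      + (2 * z * A + b) * r2 - I * (2 * z * (B + C) + 1 + A - a) * i0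
      - I * (2 * z * A - (B + C) + b) * i1 - I * (2 * z * A + b) * i2
      - ((z ^ 2 * (B + C) + z * (1 + A - a) + b) * (2 * z * (B + C) + 1 + A - a)
        + (z ^ 2 * A - z * (B + C) + z * b + a) * (2 * z * A - (B + C) + b)
        + (z ^ 2 * A + z * b - 1) * (2 * z * A + b)) * hI
  refine ⟨?_, hH⟩
  apply (mul_eq_zero.mp _).resolve_right hD
  clear hDD
  linear_combination R0 + R1 + R2 + I0 + I1 + I2 - 2 * A * (B + C) * hH - 2 * hK
end
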